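/- arXiv:2305.16906 — 4 statements merged into one kernel-verified Lean document; each statement's English description precedes it below -/
import Mathlib

section
/- Let (X,S) be an HHS with constant E and let U, V ∈ S^∞ be orthogonal domains (U ⊥ V, with diam CU = diam CV = ∞). Then the intersection P_U ∩ P_V of the standard product regions has infinite diameter. -/
/-!
Background definitions for formalizing results of Abbott–Behrstock–Russell,
"Boundaries of relatively hyperbolic hierarchically hyperbolic groups".
-/

namespace HHSPaper

open Set

universe u v

/-- A (candidate pseudo)metric on `A`, given by a bare distance function. -/
structure PMet (A : Type u) where
  d : A → A → ℝ

namespace PMet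

variable {A : Type u} {B : Type v}

/-- The distance function is a pseudometric. -/
def IsPseudo (m : PMet A) : Prop :=
  (∀ a, m.d a a = 0) ∧ (∀ a b, m.d a b = m.d b a) ∧
  (∀ a b c, m.d a c ≤ m.d a b + m.d b c) ∧ (∀ a b, 0 ≤ m.d a b)

/-- The distance function is a metric. -/
def IsMetric (m : PMet A) : Prop :=
  m.IsPseudo ∧ ∀ a b, m.d a b = 0 → a = b

/-- Gromov product of `x` and `y` with respect to `z`. -/
noncomputable def gp (m : PMet A) (z x y : A) : ℝ := (m.d x z + m.d y z - m.d x y) / 2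

/-- δ-hyperbolicity, via the four-point condition on Gromov products. -/
def IsHyp (m : PMet A) (δ : ℝ) : Prop :=
  ∀ w x y z, min (m.gp w x y) (m.gp w y z) - δ ≤ m.gp w x z

/-- Distance between two subsets (infimum of pairwise distances). -/
noncomputable def setDist (m : PMet A) (s t : Set A) : ℝ := sInf (Set.image2 m.d s t)

/-- The set `s` has diameter at most `r`. -/
def diamLE (m : PMet A) (s : Set A) (r : ℝ) : Prop := ∀ a ∈ s, ∀ b ∈ s, m.d a b ≤ r

/-- The set `s` has infinite (unbounded) diameter. -/
def Unbounded (m : PMet A) (s : Set A) : Prop := ∀ r : ℝ, ∃ a ∈ s, ∃ b ∈ s, r < m.d a b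

/-- Closed `r`-neighborhood of a set. -/
def nbhd (m : PMet A) (s : Set A) (r : ℝ) : Set A := {a | ∃ b ∈ s, m.d a b ≤ r}

/-- The subset `s` is `r`-coarsely onto: every point of the ambient space is within `r`
of a point of `s`. -/
def coarselyOnto (m : PMet A) (r : ℝ) (s : Set A) : Prop := ∀ a : A, ∃ b ∈ s, m.d a b ≤ r

/-- The two subsets are `r`-coarsely equal. -/
def coarseEq (m : PMet A) (r : ℝ) (s t : Set A) : Prop :=
  (∀ a ∈ s, ∃ b ∈ t, m.d a b ≤ r) ∧ (∀ b ∈ t, ∃ a ∈ s, m.d a b ≤ r)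

/-- `P` is `c`-coarsely connected: any two points of `P` are joined by a discrete unit-step
path staying in the `c`-neighborhood of `P`. -/
def CoarselyConnected (m : PMet A) (c : ℝ) (P : Set A) : Prop :=
  ∀ p ∈ P, ∀ q ∈ P, ∃ l : List A, l.head? = some p ∧ l.getLast? = some q ∧
    (∀ a ∈ l, a ∈ m.nbhd P c) ∧ l.Chain' (fun a b => m.d a b ≤ 1)

/-- A geodesic from `p` to `q`, parametrized by arclength on `[0, d p q]`. -/
def IsGeodesicFrom (m : PMet A) (γ : ℝ → A) (p q : A) : Prop :=
  γ 0 = p ∧ γ (m.d p q) = q ∧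
    ∀ s t : ℝ, 0 ≤ s → s ≤ t → t ≤ m.d p q → m.d (γ s) (γ t) = t - s

/-- A (λ, ε)-quasi-geodesic defined on the interval `[0, T]`. -/
def IsQuasiGeodesic (m : PMet A) (lam eps : ℝ) (γ : ℝ → A) (T : ℝ) : Prop :=
  ∀ s t : ℝ, s ∈ Set.Icc 0 T → t ∈ Set.Icc 0 T →
    |s - t| / lam - eps ≤ m.d (γ s) (γ t) ∧ m.d (γ s) (γ t) ≤ lam * |s - t| + eps

/-- A (λ, ε)-quasi-geodesic space: any two points are joined by a (λ, ε)-quasi-geodesic. -/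
def QuasiGeodesicSpace (m : PMet A) (lam eps : ℝ) : Prop :=
  ∀ a b : A, ∃ γ T, 0 ≤ T ∧ γ 0 = a ∧ γ T = b ∧ m.IsQuasiGeodesic lam eps γ T

/-- `s` is `μ`-quasiconvex: geodesics between points of `s` stay `μ`-close to `s`. -/
def quasiconvexIn (m : PMet A) (μ : ℝ) (s : Set A) : Prop :=
  ∀ p ∈ s, ∀ q ∈ s, ∀ γ : ℝ → A, m.IsGeodesicFrom γ p q →
    ∀ t ∈ Set.Icc 0 (m.d p q), m.setDist {γ t} s ≤ μ

/-- `ℓ¹` product of two distance functions. -/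
noncomputable def prod (m : PMet A) (m' : PMet B) : PMet (A × B) :=
  ⟨fun p q => m.d p.1 q.1 + m'.d p.2 q.2⟩

/-- Restriction of a distance function to a subset. -/
def restrict (m : PMet A) (s : Set A) : PMet s := ⟨fun a b => m.d a b⟩

end PMet

/-- `f` is a (λ, ε)-quasi-isometry from `(A, mA)` to `(B, mB)`. -/
def IsQuasiIsometry {A : Type u} {B : Type v} (mA : PMet A) (mB : PMet B)
    (lam eps : ℝ) (f : A → B) : Prop :=
  (∀ a a', mA.d a a' / lam - eps ≤ mB.d (f a) (f a')) ∧
  (∀ a a', mB.d (f a) (f a') ≤ lam * mA.d a a' + eps) ∧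
  (∀ b, ∃ a, mB.d (f a) b ≤ eps)

/-- `(A, m)` is quasi-isometric to the direct product of two infinite-diameter
quasi-geodesic metric spaces. -/
def QIToProductOfUnboundeds {A : Type u} (m : PMet A) : Prop :=
  ∃ (B C : Type u) (mB : PMet B) (mC : PMet C)
    (lam eps lamB epsB lamC epsC : ℝ) (f : A → B × C),
    1 ≤ lam ∧ 0 ≤ eps ∧
    mB.IsPseudo ∧ mC.IsPseudo ∧
    mB.QuasiGeodesicSpace lamB epsB ∧ mC.QuasiGeodesicSpace lamC epsC ∧
    mB.Unbounded Set.univ ∧ mC.Unbounded Set.univ ∧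
    IsQuasiIsometry m (mB.prod mC) lam eps f

/-- Total cost of a discrete chain of points, for an `ℝ≥0∞`-valued edge-cost function. -/
noncomputable def chainCost {A : Type u} (c : A → A → ENNReal) : List A → ENNReal
  | [] => 0
  | [_] => 0
  | a :: b :: l => c a b + chainCost c (b :: l)

/-- Path (chain) pseudo-distance induced by an edge-cost function. -/
noncomputable def pathDist {A : Type u} (c : A → A → ENNReal) (x y : A) : ENNReal :=
  sInf (chainCost c '' {l : List A | l.head? = some x ∧ l.getLast? = some y})

/-- A sequence converging to infinity in the sense of Gromov. -/
def ConvInf {A : Type u} (m : PMet A) (u : ℕ → A) : Prop :=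
  ∀ (z : A) (r : ℝ), ∃ N, ∀ i ≥ N, ∀ j ≥ N, r ≤ m.gp z (u i) (u j)

/-- Two sequences converging to infinity are asymptotic. -/
def AsympSeq {A : Type u} (m : PMet A) (u v : ℕ → A) : Prop :=
  ∀ (z : A) (r : ℝ), ∃ N, ∀ i ≥ N, ∀ j ≥ N, r ≤ m.gp z (u i) (v j)

/-- The Gromov boundary of `(A, m)`: sequences converging to infinity modulo asymptoticity. -/
def GBoundary {A : Type u} (m : PMet A) : Type u :=
  Quot (fun u v : {u : ℕ → A // ConvInf m u} => AsympSeq m u.1 v.1)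

/-- The Gromov product `(x | ξ)_{x₀}` with the (unique) point `ξ` at infinity: the supremum
over all sequences converging to infinity of the liminf of the Gromov products. -/
noncomputable def gpBoundaryAll {A : Type u} (m : PMet A) (x0 x : A) : ℝ :=
  sSup {r : ℝ | ∃ u : ℕ → A, ConvInf m u ∧
    r = Filter.liminf (fun n => m.gp x0 x (u n)) Filter.atTop}

/-- The word metric on a group with respect to a generating set `T`. -/
noncomputable def wordDist {G : Type u} [Group G] (T : Set G) (g h : G) : ℝ :=
  sInf ((fun l : List G => (l.length : ℝ)) ''
    {l : List G | (∀ x ∈ l, x ∈ T ∨ x⁻¹ ∈ T) ∧ g * l.prod = h})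

/-- The data of a candidate hierarchically hyperbolic structure on `X`. -/
structure PreHHS (X : Type u) : Type (u + 1) where
  S : Type u
  C : S → Type u
  m : ∀ W, PMet (C W)
  π : ∀ W, X → Set (C W)
  nest : S → S → Prop
  top : S
  orth : S → S → Prop
  ρ : ∀ _ W : S, Set (C W)

namespace PreHHS

variable {X : Type u} (P : PreHHS X)

/-- Transversality: the two domains are neither nested nor orthogonal. -/
def Transv (V W : P.S) : Prop := ¬ P.nest V W ∧ ¬ P.nest W V ∧ ¬ P.orth V W

/-- Proper nesting. -/
def ProperNest (V W : P.S) : Prop := P.nest V W ∧ V ≠ W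

/-- `W ∈ S^∞`: the associated hyperbolic space has infinite diameter. -/
def Unbdd (W : P.S) : Prop := (P.m W).Unbounded Set.univ

/-- The distance in `C W` between the projections of `x` and `y`. -/
noncomputable def pdist (W : P.S) (x y : X) : ℝ := (P.m W).setDist (P.π W x) (P.π W y)

/-- The projection of a subset `Y ⊆ X` to `C W`. -/
def projSet (W : P.S) (Y : Set X) : Set (P.C W) := ⋃ y ∈ Y, P.π W y

/-- The standard product region of `W` (with hierarchy constant `E`). -/
def productRegion (E : ℝ) (W : P.S) : Set X :=
  {x | ∀ V, P.Transv W V ∨ P.ProperNest W V → (P.m V).setDist (P.π V x) (P.ρ W V) ≤ E}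

end PreHHS

/-- The axioms (Behrstock–Hagen–Sisto) for `P` to be a hierarchically hyperbolic space
structure with constant `E` on the quasi-geodesic space `(X, mX)`. -/
structure IsHHS {X : Type u} (mX : PMet X) (E : ℝ) (P : PreHHS X) : Prop where
  one_le : 1 ≤ E
  ambient_pseudo : mX.IsPseudo
  ambient_qg : mX.QuasiGeodesicSpace E E
  space_pseudo : ∀ W, (P.m W).IsPseudo
  space_hyp : ∀ W, (P.m W).IsHyp E
  π_ne : ∀ W x, (P.π W x).Nonempty
  π_bdd : ∀ W x, (P.m W).diamLE (P.π W x) E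
  π_lip : ∀ W x y, (P.m W).setDist (P.π W x) (P.π W y) ≤ E * mX.d x y + E
  π_onto : ∀ W, (P.m W).coarselyOnto E (P.projSet W Set.univ)
  nest_refl : ∀ W, P.nest W W
  nest_antisymm : ∀ V W, P.nest V W → P.nest W V → V = W
  nest_trans : ∀ U V W, P.nest U V → P.nest V W → P.nest U W
  nest_top : ∀ W, P.nest W P.top
  orth_symm : ∀ V W, P.orth V W → P.orth W V
  orth_not_nest : ∀ V W, P.orth V W → ¬ P.nest V W
  orth_nest : ∀ U V W, P.nest V W → P.orth W U → P.orth V U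
  ρ_ne : ∀ V W, P.Transv V W ∨ P.ProperNest V W → (P.ρ V W).Nonempty
  ρ_bdd : ∀ V W, P.Transv V W ∨ P.ProperNest V W → (P.m W).diamLE (P.ρ V W) E
  complexity : ∀ l : List P.S, List.Chain' (fun a b => P.ProperNest a b) l → (l.length : ℝ) ≤ E
  containers : ∀ W U, P.ProperNest U W → (∃ V, P.nest V W ∧ P.orth V U) →
    ∃ Q, P.nest Q W ∧ ∀ V, P.nest V W → P.orth V U → P.nest V Q
  uniq : ∀ r : ℝ, ∃ θ : ℝ, ∀ x y, θ ≤ mX.d x y → ∃ W, r ≤ P.pdist W x y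
  bgi : ∀ V W x y, P.ProperNest V W → E ≤ P.pdist V x y →
    ∀ p ∈ P.π W x, ∀ q ∈ P.π W y, ∀ γ, (P.m W).IsGeodesicFrom γ p q →
      ∃ t ∈ Set.Icc 0 ((P.m W).d p q), (P.m W).setDist {γ t} (P.ρ V W) ≤ E
  large_links : ∀ W x y, ∃ l : List P.S, (∀ V ∈ l, P.ProperNest V W) ∧
    (l.length : ℝ) ≤ E * P.pdist W x y + E ∧
    ∀ U, P.ProperNest U W → (∃ V ∈ l, P.nest U V) ∨ P.pdist U x y ≤ E
  consistency₁ : ∀ x V W, P.Transv V W →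
    min ((P.m W).setDist (P.π W x) (P.ρ V W)) ((P.m V).setDist (P.π V x) (P.ρ W V)) ≤ E
  consistency₂ : ∀ U V W, P.nest U V →
    (P.ProperNest V W ∨ (P.Transv V W ∧ ¬ P.orth W U)) →
    (P.m W).setDist (P.ρ U W) (P.ρ V W) ≤ E
  partial_realization : ∀ (n : ℕ) (V : Fin n → P.S),
    (∀ i j, i ≠ j → P.orth (V i) (V j)) → ∀ p : ∀ i, P.C (V i),
    ∃ x : X, (∀ i, (P.m (V i)).setDist (P.π (V i) x) {p i} ≤ E) ∧
      ∀ i W, P.ProperNest (V i) W ∨ P.Transv (V i) W →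
        (P.m W).setDist (P.π W x) (P.ρ (V i) W) ≤ E

/-- `Y` is `k`-hierarchically quasiconvex in `(X, mX, P)`. -/
def HQC {X : Type u} (mX : PMet X) (P : PreHHS X) (k : ℝ → ℝ) (Y : Set X) : Prop :=
  (∀ W, (P.m W).quasiconvexIn (k 0) (P.projSet W Y)) ∧
  ∀ (r : ℝ) (x : X), (∀ W, (P.m W).setDist (P.π W x) (P.projSet W Y) ≤ r) →
    mX.setDist {x} Y ≤ k r

/-- `Y` has the `B`-orthogonal projection dichotomy. -/
def OrthProjDichotomy {X : Type u} (P : PreHHS X) (B : ℝ) (Y : Set X) : Prop :=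
  ∀ W, ¬ (P.m W).diamLE (P.projSet W Y) B →
    ∀ V, P.orth V W → (P.m V).coarselyOnto B (P.projSet V Y)

/-- A `G`-HHS structure with constant `E`: an HHS structure on `G` with a finitely generated
word metric, with the bounded domain dichotomy, together with a compatible `G`-action having
finitely many orbits on the unbounded domains. -/
structure GHHS (G : Type u) [Group G] (E : ℝ) : Type (u + 1) where
  T : Finset G
  gen : Subgroup.closure (T : Set G) = ⊤
  mG : PMet G
  mG_word : ∀ g h, mG.d g h = wordDist (T : Set G) g h
  pre : PreHHS G
  ax : IsHHS mG E pre
  D : ℝ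
  bdd_dichotomy : ∀ W, ¬ pre.Unbdd W → (pre.m W).diamLE Set.univ D
  act : G → pre.S → pre.S
  act_one : ∀ W, act 1 W = W
  act_mul : ∀ g h W, act (g * h) W = act g (act h W)
  act_nest : ∀ g V W, pre.nest V W → pre.nest (act g V) (act g W)
  act_orth : ∀ g V W, pre.orth V W → pre.orth (act g V) (act g W)
  finorb : ∃ (n : ℕ) (reps : Fin n → pre.S), ∀ W, pre.Unbdd W → ∃ i g, act g (reps i) = W
  iso : ∀ (g : G) (W : pre.S), pre.C W → pre.C (act g W)
  iso_isometry : ∀ g W a b, (pre.m (act g W)).d (iso g W a) (iso g W b) = (pre.m W).d a b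
  iso_bij : ∀ g W, Function.Bijective (iso g W)
  iso_cocycle : ∀ g h W a, (act_mul g h W) ▸ (iso (g * h) W a) = iso g (act h W) (iso h W a)
  iso_proj : ∀ g W x,
    (pre.m (act g W)).coarseEq E ((iso g W) '' (pre.π W x)) (pre.π (act g W) (g * x))
  iso_rho : ∀ g V W, pre.Transv V W ∨ pre.ProperNest V W →
    (pre.m (act g W)).coarseEq E ((iso g W) '' (pre.ρ V W)) (pre.ρ (act g V) (act g W))

/-- A `G`-HHS has finitely many orbits of domains (i.e., it is an HHG structure). -/
def FiniteOrbitsAll {G : Type u} [Group G] {E : ℝ} (𝔊 : GHHS G E) : Prop :=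
  ∃ (n : ℕ) (reps : Fin n → 𝔊.pre.S), ∀ W, ∃ i g, 𝔊.act g (reps i) = W

open scoped Classical

/-- Cost function for the cone-off of `G` along the standard product regions. -/
noncomputable def coneCost {G : Type u} (mG : PMet G) (P : PreHHS G) (E : ℝ)
    (x y : G) : ENNReal :=
  if ∃ W, W ≠ P.top ∧ x ∈ P.productRegion E W ∧ y ∈ P.productRegion E W
  then ENNReal.ofReal (min 1 (mG.d x y)) else ENNReal.ofReal (mG.d x y)

/-- A maximized `G`-HHS structure (in the sense of Abbott–Behrstock–Durham's maximization
procedure): every non-maximal domain nests, and is orthogonal to, an unbounded domain; every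
standard product region is quasi-isometric to a product of two unbounded quasi-geodesic
spaces; and the hyperbolic space of the maximal domain is the cone-off of `G` along the
standard product regions. -/
structure Maximized {G : Type u} [Group G] {E : ℝ} (𝔊 : GHHS G E) : Prop where
  nested_unbdd : ∀ W, ∃ U, 𝔊.pre.nest U W ∧ 𝔊.pre.Unbdd U
  orth_unbdd : ∀ W, W ≠ 𝔊.pre.top → ∃ U, 𝔊.pre.orth U W ∧ 𝔊.pre.Unbdd U
  pr_wide : ∀ W, QIToProductOfUnboundeds (𝔊.mG.restrict (𝔊.pre.productRegion E W))
  cone_off : ∃ e : G → 𝔊.pre.C 𝔊.pre.top, Function.Surjective e ∧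
    (∀ x, 𝔊.pre.π 𝔊.pre.top x = {e x}) ∧
    ∀ x y, ENNReal.ofReal ((𝔊.pre.m 𝔊.pre.top).d (e x) (e y)) =
      pathDist (coneCost 𝔊.mG 𝔊.pre E) x y

/-- Almost malnormality of a collection of subgroups. -/
def AlmostMalnormal {G : Type u} [Group G] {k : ℕ} (Hs : Fin k → Subgroup G) : Prop :=
  ∀ i j (g : G), {x : G | x ∈ Hs j ∧ g⁻¹ * x * g ∈ Hs i}.Infinite → i = j ∧ g ∈ Hs i

/-- `Y` is a strongly quasiconvex subset of `(G, m)`. -/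
def StronglyQC {G : Type u} (m : PMet G) (Y : Set G) : Prop :=
  ∃ M : ℝ → ℝ → ℝ, ∀ lam eps : ℝ, 1 ≤ lam → 0 ≤ eps →
    ∀ γ T, m.IsQuasiGeodesic lam eps γ T → 0 ≤ T → γ 0 ∈ Y → γ T ∈ Y →
      ∀ t ∈ Set.Icc 0 T, ∃ z ∈ Y, m.d (γ t) z ≤ M lam eps

/-- A hyperbolically embedded collection of subgroups of a `G`-HHS (equivalently, by
Russell–Spriano–Tran, an almost malnormal collection of strongly quasiconvex subgroups). -/
def HypEmbedded {G : Type u} [Group G] {k : ℕ} (mG : PMet G) (Hs : Fin k → Subgroup G) : Prop :=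
  AlmostMalnormal Hs ∧ ∀ i, StronglyQC mG ((Hs i : Set G))

/-- Index set for the collection of all cosets of the subgroups `H₁, …, H_k`. -/
abbrev CosetIdx (G : Type u) [Group G] {k : ℕ} (Hs : Fin k → Subgroup G) : Type u :=
  Σ i : Fin k, G ⧸ Hs i

/-- The coset of `G` indexed by `Q`. -/
def cosetSet {G : Type u} [Group G] {k : ℕ} {Hs : Fin k → Subgroup G} :
    CosetIdx G Hs → Set G
  | ⟨i, q⟩ => {g : G | (QuotientGroup.mk g : G ⧸ Hs i) = q}

/-- Coarse closest point projection onto a subset. -/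
noncomputable def cpp {A : Type u} (m : PMet A) (s : Set A) (p : A) : Set A :=
  {a ∈ s | m.d p a ≤ m.setDist {p} s + 1}

section Construction

variable {G : Type u} [Group G] {E : ℝ} {k : ℕ} (𝔊 : GHHS G E) (Hs : Fin k → Subgroup G)

/-- Cost function for the electrification of `C S` along the projections of the cosets. -/
noncomputable def elecCost (p q : 𝔊.pre.C 𝔊.pre.top) : ENNReal :=
  if ∃ Q : CosetIdx G Hs, p ∈ 𝔊.pre.projSet 𝔊.pre.top (cosetSet Q) ∧
       q ∈ 𝔊.pre.projSet 𝔊.pre.top (cosetSet Q)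
  then ENNReal.ofReal (min 1 ((𝔊.pre.m 𝔊.pre.top).d p q))
  else ENNReal.ofReal ((𝔊.pre.m 𝔊.pre.top).d p q)

/-- The electrified space: `C S` with the electrified (path) metric. -/
noncomputable def elecPMet : PMet (𝔊.pre.C 𝔊.pre.top) :=
  ⟨fun p q => (pathDist (elecCost 𝔊 Hs) p q).toReal⟩

/-- The convex hull of `π_S(⌊Q⌋)` in `C S`. -/
def hullSet (Q : CosetIdx G Hs) : Set (𝔊.pre.C 𝔊.pre.top) :=
  𝔊.pre.projSet 𝔊.pre.top (cosetSet Q) ∪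
  {p | ∃ a ∈ 𝔊.pre.projSet 𝔊.pre.top (cosetSet Q),
       ∃ b ∈ 𝔊.pre.projSet 𝔊.pre.top (cosetSet Q),
     ∃ γ t, (𝔊.pre.m 𝔊.pre.top).IsGeodesicFrom γ a b ∧
       t ∈ Set.Icc 0 ((𝔊.pre.m 𝔊.pre.top).d a b) ∧ γ t = p}

/-- The projection to the coset domain `Q`: the closest point projection to `π_S(⌊Q⌋)`
composed with `π_S`, as a subset of `C S`. -/
noncomputable def tauQ (Q : CosetIdx G Hs) (x : G) : Set (𝔊.pre.C 𝔊.pre.top) :=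
  ⋃ p ∈ 𝔊.pre.π 𝔊.pre.top x,
    cpp (𝔊.pre.m 𝔊.pre.top) (𝔊.pre.projSet 𝔊.pre.top (cosetSet Q)) p

/-- Nesting of an old domain `V` into a coset domain `Q`: some unbounded domain orthogonal
to `V` has `π_W` coarsely onto on the coset. -/
def nestIntoCoset (V : 𝔊.pre.S) (Q : CosetIdx G Hs) : Prop :=
  V ≠ 𝔊.pre.top ∧ ∃ W, 𝔊.pre.Unbdd W ∧ 𝔊.pre.orth W V ∧
    ∃ r : ℝ, (𝔊.pre.m W).coarselyOnto r (𝔊.pre.projSet W (cosetSet Q))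

/-- Index set of the new structure `H`. -/
abbrev ConS : Type u := 𝔊.pre.S ⊕ CosetIdx G Hs

/-- Hyperbolic spaces of the new structure `H`. -/
def conC : ConS 𝔊 Hs → Type u
  | Sum.inl V => 𝔊.pre.C V
  | Sum.inr Q => {p : 𝔊.pre.C 𝔊.pre.top // p ∈ hullSet 𝔊 Hs Q}

/-- The metrics of the new hyperbolic spaces: the electrified metric for the maximal domain,
the subspace metric of the convex hull for a coset domain, and the old metrics otherwise. -/
noncomputable def conM : ∀ W : ConS 𝔊 Hs, PMet (conC 𝔊 Hs W)
  | Sum.inl V =>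
      if h : V = 𝔊.pre.top then (by subst h; exact elecPMet 𝔊 Hs) else 𝔊.pre.m V
  | Sum.inr Q => (𝔊.pre.m 𝔊.pre.top).restrict (hullSet 𝔊 Hs Q)

/-- The projections of the new structure `H`. -/
noncomputable def conπ : ∀ W : ConS 𝔊 Hs, G → Set (conC 𝔊 Hs W)
  | Sum.inl V => 𝔊.pre.π V
  | Sum.inr Q => fun x => Subtype.val ⁻¹' (tauQ 𝔊 Hs Q x)

/-- The nesting relation of the new structure `H`. -/
def conNest : ConS 𝔊 Hs → ConS 𝔊 Hs → Prop
  | Sum.inl V, Sum.inl W => 𝔊.pre.nest V W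
  | Sum.inl V, Sum.inr Q => nestIntoCoset 𝔊 Hs V Q
  | Sum.inr _, Sum.inl W => W = 𝔊.pre.top
  | Sum.inr Q, Sum.inr R => Q = R

/-- The orthogonality relation of the new structure `H` (same as the old one). -/
def conOrth : ConS 𝔊 Hs → ConS 𝔊 Hs → Prop
  | Sum.inl V, Sum.inl W => 𝔊.pre.orth V W
  | _, _ => False

/-- The relative projections of the new structure `H`. -/
noncomputable def conρ : ∀ (_ W : ConS 𝔊 Hs), Set (conC 𝔊 Hs W)
  | Sum.inl V, Sum.inl W => 𝔊.pre.ρ V W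
  | Sum.inr Q, Sum.inl W => 𝔊.pre.projSet W (cosetSet Q)
  | Sum.inl V, Sum.inr Q => Subtype.val ⁻¹'
      (⋃ p ∈ 𝔊.pre.ρ V 𝔊.pre.top,
        cpp (𝔊.pre.m 𝔊.pre.top) (𝔊.pre.projSet 𝔊.pre.top (cosetSet Q)) p)
  | Sum.inr R, Sum.inr Q => Subtype.val ⁻¹' (⋃ g ∈ cosetSet R, tauQ 𝔊 Hs Q g)

/-- Construction 3.1: the structure `H` obtained by adjoining the cosets of a hyperbolically
embedded collection of subgroups to a maximized `G`-HHS structure. -/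
noncomputable def conStruct : PreHHS G where
  S := ConS 𝔊 Hs
  C := conC 𝔊 Hs
  m := conM 𝔊 Hs
  π := conπ 𝔊 Hs
  nest := conNest 𝔊 Hs
  top := Sum.inl 𝔊.pre.top
  orth := conOrth 𝔊 Hs
  ρ := conρ 𝔊 Hs

end Construction

/-- The cusped space of `G` over the cosets of the subgroups `Hs`: `G` together with a
combinatorial horoball over each coset. -/
abbrev Cusp (G : Type u) [Group G] {k : ℕ} (Hs : Fin k → Subgroup G) : Type u :=
  G ⊕ (CosetIdx G Hs × G × ℕ)

/-- Edge costs for the cusped space: `G` keeps its word metric; each coset element is glued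
by a unit edge to the depth-0 horoball vertex over it; vertical horoball edges have length 1;
horizontal horoball edges at depth `n` have length `e^{-n}`. -/
noncomputable def cuspCost {G : Type u} [Group G] {k : ℕ} (mG : PMet G)
    (Hs : Fin k → Subgroup G) : Cusp G Hs → Cusp G Hs → ENNReal
  | Sum.inl g, Sum.inl h => ENNReal.ofReal (mG.d g h)
  | Sum.inl g, Sum.inr (Q, p, n) => if g = p ∧ p ∈ cosetSet Q ∧ n = 0 then 1 else ⊤
  | Sum.inr (Q, p, n), Sum.inl h => if h = p ∧ p ∈ cosetSet Q ∧ n = 0 then 1 else ⊤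
  | Sum.inr (Q, p, n), Sum.inr (R, q, mm) =>
      if Q = R ∧ p ∈ cosetSet Q ∧ q ∈ cosetSet Q then
        (if p = q ∧ (mm = n + 1 ∨ n = mm + 1) then 1
         else if n = mm ∧ p ≠ q ∧ mG.d p q ≤ 2 then ENNReal.ofReal (Real.exp (-(n : ℝ)))
         else ⊤)
      else ⊤

/-- The cusped space with its path metric. -/
noncomputable def cuspPMet {G : Type u} [Group G] {k : ℕ} (mG : PMet G)
    (Hs : Fin k → Subgroup G) : PMet (Cusp G Hs) :=
  ⟨fun x y => (pathDist (cuspCost mG Hs) x y).toReal⟩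

/-- `G` (with word metric `mG`) is hyperbolic relative to the subgroups `Hs`: the cusped
space is connected and Gromov hyperbolic. -/
def RelHyp {G : Type u} [Group G] {k : ℕ} (mG : PMet G) (Hs : Fin k → Subgroup G) : Prop :=
  (∀ x y : Cusp G Hs, pathDist (cuspCost mG Hs) x y ≠ ⊤) ∧
  ∃ δ : ℝ, (cuspPMet mG Hs).IsHyp δ

/-- Orthogonality of the structure `P` is isolated by the set of domains `I`. -/
def IsolatedOrth {X : Type u} (P : PreHHS X) (I : Set P.S) : Prop :=
  P.top ∉ I ∧
  (∀ V W, P.orth V W → ∃ J ∈ I, P.ProperNest V J ∧ P.ProperNest W J) ∧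
  (∀ W J₁ J₂, J₁ ∈ I → J₂ ∈ I → P.nest W J₁ → P.nest W J₂ → J₁ = J₂)

/-- `Ws` is the set of eyries for the subgroup `H`: a nonempty pairwise orthogonal set of
domains on which `H` has unbounded projection, such that every domain with unbounded
`H`-projection is nested into one of them. -/
def IsEyrieSet {G : Type u} [Group G] {E : ℝ} (𝔊 : GHHS G E) (Hsub : Subgroup G)
    (Ws : Finset 𝔊.pre.S) : Prop :=
  Ws.Nonempty ∧
  (∀ V ∈ Ws, ∀ W ∈ Ws, V ≠ W → 𝔊.pre.orth V W) ∧
  (∀ W ∈ Ws, (𝔊.pre.m W).Unbounded (𝔊.pre.projSet W (Hsub : Set G))) ∧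
  (∀ V, (𝔊.pre.m V).Unbounded (𝔊.pre.projSet V (Hsub : Set G)) → ∃ W ∈ Ws, 𝔊.pre.nest V W)

/-- A group is virtually cyclic if it has a cyclic subgroup of finite index. -/
def VirtuallyCyclic (H : Type u) [Group H] : Prop :=
  ∃ K : Subgroup H, IsCyclic K ∧ K.FiniteIndex

/-- A group is acylindrically hyperbolic if it is not virtually cyclic and admits an
acylindrical isometric action with unbounded orbits on a geodesic Gromov hyperbolic space. -/
def AcylindricallyHyperbolic (H : Type u) [Group H] : Prop :=
  ¬ VirtuallyCyclic H ∧
  ∃ (Z : Type u) (mZ : PMet Z) (δ : ℝ) (a : H → Z → Z),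
    mZ.IsMetric ∧ mZ.IsHyp δ ∧ (∀ x y : Z, ∃ γ, mZ.IsGeodesicFrom γ x y) ∧
    (∀ h h' x, a (h * h') x = a h (a h' x)) ∧ (∀ x, a 1 x = x) ∧
    (∀ h x y, mZ.d (a h x) (a h y) = mZ.d x y) ∧
    (∀ ε : ℝ, 0 ≤ ε → ∃ (R : ℝ) (N : ℕ), ∀ x y, R ≤ mZ.d x y →
      ({h : H | mZ.d x (a h x) ≤ ε ∧ mZ.d y (a h y) ≤ ε}).Finite ∧
      Nat.card {h : H | mZ.d x (a h x) ≤ ε ∧ mZ.d y (a h y) ≤ ε} ≤ N) ∧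
    (∃ x, mZ.Unbounded (Set.range fun h => a h x))

section Boundary

variable {G : Type u} [Group G] {E : ℝ} (𝔊 : GHHS G E)

/-- A vertex of the simplicial HHS boundary: a domain together with a point of the
Gromov boundary of its hyperbolic space. -/
abbrev SBdryVert : Type u := Σ W : 𝔊.pre.S, GBoundary (𝔊.pre.m W)

/-- Two boundary vertices are adjacent iff their supports are orthogonal. -/
def bAdj (a b : SBdryVert 𝔊) : Prop := 𝔊.pre.orth a.1 b.1

lemma convInf_push (g : G) (W : 𝔊.pre.S) (u : ℕ → 𝔊.pre.C W)
    (hu : ConvInf (𝔊.pre.m W) u) :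
    ConvInf (𝔊.pre.m (𝔊.act g W)) (fun n => 𝔊.iso g W (u n)) := by
  intro z r
  obtain ⟨z0, rfl⟩ := (𝔊.iso_bij g W).2 z
  obtain ⟨N, hN⟩ := hu z0 r
  refine ⟨N, fun i hi j hj => ?_⟩
  have h := hN i hi j hj
  simpa only [PMet.gp, 𝔊.iso_isometry] using h

lemma asympSeq_push (g : G) (W : 𝔊.pre.S) (u v : ℕ → 𝔊.pre.C W)
    (huv : AsympSeq (𝔊.pre.m W) u v) :
    AsympSeq (𝔊.pre.m (𝔊.act g W)) (fun n => 𝔊.iso g W (u n)) (fun n => 𝔊.iso g W (v n)) := by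
  intro z r
  obtain ⟨z0, rfl⟩ := (𝔊.iso_bij g W).2 z
  obtain ⟨N, hN⟩ := huv z0 r
  refine ⟨N, fun i hi j hj => ?_⟩
  have h := hN i hi j hj
  simpa only [PMet.gp, 𝔊.iso_isometry] using h

/-- The pushforward of a boundary point under the isometry `g_W : C W → C (gW)`. -/
noncomputable def bdryPush (g : G) (W : 𝔊.pre.S) :
    GBoundary (𝔊.pre.m W) → GBoundary (𝔊.pre.m (𝔊.act g W)) :=
  Quot.map (fun u => ⟨fun n => 𝔊.iso g W (u.1 n), convInf_push 𝔊 g W u.1 u.2⟩)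
    (fun u v h => asympSeq_push 𝔊 g W u.1 v.1 h)

/-- The action of `G` on the vertices of the simplicial HHS boundary. -/
noncomputable def bAct (g : G) (a : SBdryVert 𝔊) : SBdryVert 𝔊 :=
  ⟨𝔊.act g a.1, bdryPush 𝔊 g a.1 a.2⟩

end Boundary

section Horoball

variable {Y : Type u}

/-- Vertex set of the horoball space `H(Y)` over the net `N ⊆ Y`. -/
abbrev HoroSpace (Y : Type u) (N : Set Y) : Type u := Y ⊕ (N × ℕ)

/-- Edge costs of the horoball space `H(Y)`: `Y` keeps its metric; each net point `v` is
glued by a unit edge to the horoball vertex `(v,0)`; vertical edges have length `1`;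
horizontal edges at depth `n` (between net points at `Y`-distance at most `20λ`, i.e. edges
of the approximation graph) have length `e^{-n}`. -/
noncomputable def horoCost (mY : PMet Y) (lam : ℝ) (N : Set Y) :
    HoroSpace Y N → HoroSpace Y N → ENNReal
  | Sum.inl y, Sum.inl y' => ENNReal.ofReal (mY.d y y')
  | Sum.inl y, Sum.inr (v, n) => if y = ↑v ∧ n = 0 then 1 else ⊤
  | Sum.inr (v, n), Sum.inl y => if y = ↑v ∧ n = 0 then 1 else ⊤
  | Sum.inr (v, n), Sum.inr (w, mm) =>
      if v = w ∧ (mm = n + 1 ∨ n = mm + 1) then 1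
      else if n = mm ∧ v ≠ w ∧ mY.d ↑v ↑w ≤ 20 * lam then
        ENNReal.ofReal (Real.exp (-(n : ℝ)))
      else ⊤

/-- The horoball space `H(Y)` with its path metric. -/
noncomputable def horoPMet (mY : PMet Y) (lam : ℝ) (N : Set Y) : PMet (HoroSpace Y N) :=
  ⟨fun x y => (pathDist (horoCost mY lam N) x y).toReal⟩

end Horoball


namespace PMet

variable {A : Type u} {m : PMet A} {s t : Set A}

lemma exists_d_lt_of_setDist_le (hs : s.Nonempty) (ht : t.Nonempty) {r r' : ℝ}
    (h : m.setDist s t ≤ r) (hr : r < r') : ∃ a ∈ s, ∃ b ∈ t, m.d a b < r' := by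
  obtain ⟨_, ⟨a, ha, b, hb, rfl⟩, hab⟩ :=
    exists_lt_of_csInf_lt (hs.image2 ht) (lt_of_le_of_lt h hr)
  exact ⟨a, ha, b, hb, hab⟩

lemma d_lt_add_of_setDist_le (hm : m.IsPseudo) {D D' r : ℝ} (hs : m.diamLE s D)
    (ht : m.diamLE t D') {a b : A} (ha : a ∈ s) (hb : b ∈ t) (h : m.setDist s t ≤ r) {r' : ℝ}
    (hr : r < r') : m.d a b < D + r' + D' := by
  obtain ⟨a', ha', b', hb', hab⟩ := exists_d_lt_of_setDist_le ⟨a, ha⟩ ⟨b, hb⟩ h hr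
  have h₁ := hm.2.2.1 a a' b
  have h₂ := hm.2.2.1 a' b' b
  have h₃ := hs a ha a' ha'
  have h₄ := ht b' hb' b hb
  linarith

end PMet

namespace IsHHS

variable {X : Type u} {mX : PMet X} {E : ℝ} {P : PreHHS X}

/-- Partial realization for a pair of orthogonal domains. -/
lemma exists_mem_productRegion_inter (hhs : IsHHS mX E P) {U V : P.S} (ho : P.orth U V)
    (a : P.C U) (b : P.C V) :
    ∃ x ∈ P.productRegion E U ∩ P.productRegion E V,
      (P.m U).setDist (P.π U x) {a} ≤ E ∧ (P.m V).setDist (P.π V x) {b} ≤ E := by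
  obtain ⟨x, hx, hρ⟩ := hhs.partial_realization 2 ![U, V]
    (by
      intro i j hij
      fin_cases i <;> fin_cases j
      · exact absurd rfl hij
      · exact ho
      · exact hhs.orth_symm _ _ ho
      · exact absurd rfl hij)
    (Fin.cases a (Fin.cases b (fun i => i.elim0)))
  exact ⟨x, ⟨fun W hW => hρ 0 W hW.symm, fun W hW => hρ 1 W hW.symm⟩, hx 0, hx 1⟩

/-- Points whose `U`-projections are `E`-close to far-apart points of `C U` are far apart. -/
lemma d_lt_of_setDist_singleton_le (hhs : IsHHS mX E P) {U : P.S} {x y : X} {a b : P.C U}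
    (hx : (P.m U).setDist (P.π U x) {a} ≤ E) (hy : (P.m U).setDist (P.π U y) {b} ≤ E) :
    (P.m U).d a b < E * mX.d x y + 5 * E + 3 := by
  have hm := hhs.space_pseudo U
  obtain ⟨p, hp, a', rfl, hpa⟩ := PMet.exists_d_lt_of_setDist_le (hhs.π_ne U x)
    (Set.singleton_nonempty a) hx (lt_add_one E)
  obtain ⟨q, hq, b', rfl, hqb⟩ := PMet.exists_d_lt_of_setDist_le (hhs.π_ne U y)
    (Set.singleton_nonempty b) hy (lt_add_one E)
  have hpq := PMet.d_lt_add_of_setDist_le hm (hhs.π_bdd U x) (hhs.π_bdd U y) hp hq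
    (hhs.π_lip U x y) (lt_add_one _)
  rw [hm.2.1] at hpa
  have h₁ := hm.2.2.1 a' p b'
  have h₂ := hm.2.2.1 p q b'
  linarith

end IsHHS

/-- In an HHS with constant `E`, if `U ⊥ V` and both `C U` and `C V` have
infinite diameter, then the intersection `P_U ∩ P_V` of the standard product regions has
infinite diameter. -/
theorem orthogonal_product_regions_intersect_unboundedly
    {X : Type u} (mX : PMet X) (E : ℝ) (P : PreHHS X) (hhs : IsHHS mX E P)
    (U V : P.S) (ho : P.orth U V) (hU : P.Unbdd U) (hV : P.Unbdd V) :
    mX.Unbounded (P.productRegion E U ∩ P.productRegion E V) := by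
  intro r
  obtain ⟨b, -, -⟩ := hV 0
  obtain ⟨a, -, a', -, haa'⟩ := hU (E * r + 5 * E + 3)
  obtain ⟨x, hx, hxa, -⟩ := hhs.exists_mem_productRegion_inter ho a b
  obtain ⟨y, hy, hya, -⟩ := hhs.exists_mem_productRegion_inter ho a' b
  refine ⟨x, hx, y, hy, ?_⟩
  have hlt := hhs.d_lt_of_setDist_singleton_le hxa hya
  exact lt_of_mul_lt_mul_left (by linarith) (zero_le_one.trans hhs.one_le)

end HHSPaper
end

section
/- Let Y be a (λ,λ)-quasi-geodesic metric space with basepoint x_0, let N be a 10λ-net in Y (every point of Y is within 20λ of a point of N and distinct points of N are at least 10λ apart), and let Γ be the approximation graph with vertex set N and unit-length edges between points of N at distance at most 20λ in Y. Let H(Y) be the space obtained from the combinatorial horoball H(Γ) by attaching each vertex (v,0) of H(Γ) to the point v ∈ N ⊆ Y by an edge of length 1, and let ξ be the unique Gromov boundary point of the hyperbolic space H(Y). Then there is an increasing function f : [0,∞) → [0,∞), depending only on λ, such that for all x ∈ Y and all r ≥ 0: if d_Y(x_0,x) ≥ f(r), then the Gromov product (x|ξ)_{x_0} computed in H(Y)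 is greater than r. -/
/-!
Background definitions for formalizing results of Abbott–Behrstock–Russell,
"Boundaries of relatively hyperbolic hierarchically hyperbolic groups".
-/

namespace HHSPaper

open Set

universe u v

open scoped Classical

section PathDist

variable {A : Type u} {c : A → A → ENNReal}

/-- Concatenating two chains does not increase the total cost. -/
lemma exists_chain_trans {y z : A} {l₂ : List A} (h₂ : l₂.head? = some y)
    (h₂' : l₂.getLast? = some z) :
    ∀ (l₁ : List A) (x : A), l₁.head? = some x → l₁.getLast? = some y →
      ∃ l : List A, l.head? = some x ∧ l.getLast? = some z ∧
        chainCost c l ≤ chainCost c l₁ + chainCost c l₂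
  | [], x, h, _ => by simp at h
  | [a], x, h, h' => by
      simp only [List.head?_cons, List.getLast?_singleton, Option.some.injEq] at h h'
      subst h h'
      exact ⟨l₂, h₂, h₂', by simp [chainCost]⟩
  | a :: b :: t, x, h, h' => by
      obtain ⟨l, hl, hl', hc⟩ := exists_chain_trans h₂ h₂' (b :: t) b rfl (by simpa using h')
      obtain ⟨s, rfl⟩ : ∃ s, l = b :: s := by
        cases l with
        | nil => simp at hl
        | cons d s => exact ⟨s, by simpa using hl⟩
      refine ⟨a :: b :: s, h, by simpa using hl', ?_⟩
      simp only [chainCost, add_assoc]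
      gcongr

lemma pathDist_triangle (x y z : A) : pathDist c x z ≤ pathDist c x y + pathDist c y z := by
  unfold pathDist
  rw [ENNReal.sInf_add]
  refine le_iInf₂ fun _ h => ?_
  obtain ⟨l₁, ⟨h₁, h₁'⟩, rfl⟩ := h
  rw [add_comm, ENNReal.sInf_add]
  refine le_iInf₂ fun _ h => ?_
  obtain ⟨l₂, ⟨h₂, h₂'⟩, rfl⟩ := h
  obtain ⟨l, hl, hl', hc⟩ := exists_chain_trans (c := c) h₂ h₂' l₁ x h₁ h₁'
  rw [add_comm]
  exact le_trans (sInf_le ⟨l, ⟨hl, hl'⟩, rfl⟩) hc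

lemma pathDist_self (x : A) : pathDist c x x = 0 :=
  le_antisymm (sInf_le ⟨[x], ⟨rfl, rfl⟩, rfl⟩) bot_le

lemma pathDist_le_cost (x y : A) : pathDist c x y ≤ c x y :=
  sInf_le ⟨[x, y], ⟨rfl, rfl⟩, by simp [chainCost]⟩

lemma pathDist_le_chainCost_swap (hc : ∀ a b, c a b = c b a) {y : A} :
    ∀ (l : List A) (x : A), l.head? = some x → l.getLast? = some y →
      pathDist c y x ≤ chainCost c l
  | [], x, h, _ => by simp at h
  | [a], x, h, h' => by
      simp only [List.head?_cons, List.getLast?_singleton, Option.some.injEq] at h h'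
      subst h h'
      simp [pathDist_self]
  | a :: b :: t, x, h, h' => by
      obtain rfl : a = x := by simpa using h
      have ih := pathDist_le_chainCost_swap hc (b :: t) b rfl (by simpa using h')
      calc pathDist c y a ≤ pathDist c y b + pathDist c b a := pathDist_triangle _ _ _
        _ ≤ chainCost c (b :: t) + c a b :=
            add_le_add ih ((pathDist_le_cost b a).trans (hc b a).le)
        _ = chainCost c (a :: b :: t) := add_comm _ _

lemma pathDist_comm (hc : ∀ a b, c a b = c b a) (x y : A) : pathDist c x y = pathDist c y x := by
  have key : ∀ x y : A, pathDist c y x ≤ pathDist c x y := fun x y => by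
    refine le_sInf ?_
    rintro _ ⟨l, ⟨hl, hl'⟩, rfl⟩
    exact pathDist_le_chainCost_swap hc l x hl hl'
  exact le_antisymm (key _ _) (key _ _)

end PathDist

lemma PMet.IsPseudo.gp_nonneg {A : Type u} {m : PMet A} (hm : m.IsPseudo) (z x y : A) :
    0 ≤ m.gp z x y := by
  have h₁ := hm.2.2.1 x z y
  have h₂ := hm.2.1 z y
  unfold PMet.gp
  linarith

lemma PMet.IsPseudo.gp_le_dist {A : Type u} {m : PMet A} (hm : m.IsPseudo) (z x y : A) :
    m.gp z x y ≤ m.d x z := by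
  have h₁ := hm.2.2.1 y x z
  have h₂ := hm.2.1 y x
  unfold PMet.gp
  linarith

/-- A uniform lower bound for the Gromov products along a sequence converging to infinity is a
lower bound for the Gromov product with the boundary. -/
lemma PMet.IsPseudo.le_gpBoundaryAll {A : Type u} {m : PMet A} (hm : m.IsPseudo) {x0 x : A}
    {u : ℕ → A} (hu : ConvInf m u) {r : ℝ} (hr : ∀ n, r ≤ m.gp x0 x (u n)) :
    r ≤ gpBoundaryAll m x0 x := by
  have above (v : ℕ → A) : Filter.IsBoundedUnder (· ≤ ·) Filter.atTop
      (fun n => m.gp x0 x (v n)) :=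
    Filter.isBoundedUnder_of ⟨m.d x x0, fun n => hm.gp_le_dist _ _ _⟩
  have below (v : ℕ → A) : Filter.IsBoundedUnder (· ≥ ·) Filter.atTop
      (fun n => m.gp x0 x (v n)) :=
    Filter.isBoundedUnder_of ⟨0, fun n => hm.gp_nonneg _ _ _⟩
  have hle : r ≤ Filter.liminf (fun n => m.gp x0 x (u n)) Filter.atTop :=
    Filter.le_liminf_of_le (above u).isCoboundedUnder_ge (Filter.Eventually.of_forall hr)
  refine hle.trans (le_csSup ⟨m.d x x0, ?_⟩ ⟨u, hu, rfl⟩)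
  rintro _ ⟨v, -, rfl⟩
  exact Filter.liminf_le_of_frequently_le
    (Filter.Eventually.of_forall fun n => hm.gp_le_dist _ _ _).frequently (below v)

section HoroballGeometry

variable {Y : Type u} {mY : PMet Y} {lam : ℝ} {N : Set Y}

/-- The height of a point of `H(Y)` above `Y`. -/
def horoHeight : HoroSpace Y N → ℝ
  | Sum.inl _ => 0
  | Sum.inr (_, n) => n + 1

/-- The projection of `H(Y)` to `Y`. -/
def horoProj : HoroSpace Y N → Y
  | Sum.inl y => y
  | Sum.inr (v, _) => v

lemma horoCost_comm (hY : mY.IsPseudo) (a b : HoroSpace Y N) :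
    horoCost mY lam N a b = horoCost mY lam N b a := by
  rcases a with y | ⟨v, n⟩ <;> rcases b with z | ⟨w, k⟩
  · simp only [horoCost, hY.2.1 y z]
  · rfl
  · rfl
  · simp only [horoCost, hY.2.1 v w, eq_comm (a := v), ne_comm (a := v), or_comm (a := k = n + 1)]
    by_cases h : n = k
    · subst h; rfl
    · simp [h, Ne.symm h]

lemma horo_pathDist_vertical (v : N) (n k : ℕ) :
    pathDist (horoCost mY lam N) (Sum.inr (v, n)) (Sum.inr (v, n + k)) ≤ k := by
  induction k with
  | zero => simp [pathDist_self]
  | succ k ih =>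
    refine (pathDist_triangle _ (Sum.inr (v, n + k)) _).trans ?_
    push_cast
    refine add_le_add ih ((pathDist_le_cost _ _).trans ?_)
    simp [horoCost, add_assoc]

lemma horo_pathDist_inl_inr (x : Y) (v : N) (n : ℕ) :
    pathDist (horoCost mY lam N) (Sum.inl x) (Sum.inr (v, n)) ≤
      ENNReal.ofReal (mY.d x v) + (1 + n) := by
  refine (pathDist_triangle _ (Sum.inl (v : Y)) _).trans (add_le_add (pathDist_le_cost _ _) ?_)
  refine (pathDist_triangle _ (Sum.inr (v, 0)) _).trans (add_le_add ?_ ?_)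
  · exact (pathDist_le_cost _ _).trans (by simp [horoCost])
  · simpa using horo_pathDist_vertical (mY := mY) (lam := lam) v 0 n

lemma horo_pathDist_ne_top (hY : mY.IsPseudo) (a b : HoroSpace Y N) :
    pathDist (horoCost mY lam N) a b ≠ ⊤ := by
  have base (x : Y) : ∀ b : HoroSpace Y N, pathDist (horoCost mY lam N) (Sum.inl x) b ≠ ⊤
    | Sum.inl y => ne_top_of_le_ne_top ENNReal.ofReal_ne_top (pathDist_le_cost _ _)
    | Sum.inr (v, n) => ne_top_of_le_ne_top (by finiteness) (horo_pathDist_inl_inr x v n)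
  refine ne_top_of_le_ne_top ?_ (pathDist_triangle a (Sum.inl (horoProj a)) b)
  rw [pathDist_comm (horoCost_comm hY) a]
  exact ENNReal.add_ne_top.2 ⟨base _ _, base _ _⟩

lemma horoPMet_isPseudo (hY : mY.IsPseudo) : (horoPMet mY lam N).IsPseudo := by
  refine ⟨fun a => by simp [horoPMet, pathDist_self], fun a b => ?_, fun a b c => ?_,
    fun _ _ => ENNReal.toReal_nonneg⟩
  · simp only [horoPMet, pathDist_comm (horoCost_comm hY) a b]
  · have h₁ := horo_pathDist_ne_top (lam := lam) hY a b
    have h₂ := horo_pathDist_ne_top (lam := lam) hY b c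
    simp only [horoPMet]
    rw [← ENNReal.toReal_add h₁ h₂]
    exact ENNReal.toReal_mono (ENNReal.add_ne_top.2 ⟨h₁, h₂⟩) (pathDist_triangle _ _ _)

lemma horoPMet_vertical_le (hY : mY.IsPseudo) (v : N) (n k : ℕ) :
    (horoPMet mY lam N).d (Sum.inr (v, n)) (Sum.inr (v, k)) ≤ |(n : ℝ) - k| := by
  have key (n k : ℕ) :
      (horoPMet mY lam N).d (Sum.inr (v, n)) (Sum.inr (v, n + k)) ≤ k := by
    have h := ENNReal.toReal_mono (by finiteness)
      (horo_pathDist_vertical (mY := mY) (lam := lam) v n k)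
    simpa [horoPMet] using h
  rcases le_total n k with h | h
  · obtain ⟨j, rfl⟩ := Nat.exists_eq_add_of_le h
    exact (key n j).trans (by simp)
  · obtain ⟨j, rfl⟩ := Nat.exists_eq_add_of_le h
    rw [(horoPMet_isPseudo hY).2.1]
    exact (key k j).trans (by simp)

lemma horoPMet_inl_inr_le (hY : mY.IsPseudo) (x : Y) (v : N) (n : ℕ) :
    (horoPMet mY lam N).d (Sum.inl x) (Sum.inr (v, n)) ≤ mY.d x v + (1 + n) := by
  have h := ENNReal.toReal_mono (by finiteness)
    (horo_pathDist_inl_inr (mY := mY) (lam := lam) x v n)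
  rw [ENNReal.toReal_add (by finiteness) (by finiteness),
    ENNReal.toReal_ofReal (hY.2.2.2 _ _)] at h
  simpa [horoPMet, ENNReal.toReal_add] using h

/-- An edge changes the height by at most its length, and it moves the projection to `Y` by an
amount that is at most exponential in the height. -/
lemma horo_edge_bound (hlam : 1 ≤ lam) (hY : mY.IsPseudo) (a b : HoroSpace Y N)
    (h : horoCost mY lam N a b ≠ ⊤) :
    horoHeight b ≤ horoHeight a + (horoCost mY lam N a b).toReal ∧
      mY.d (horoProj a) (horoProj b) ≤
        20 * lam * Real.exp (horoHeight a) * (horoCost mY lam N a b).toReal := by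
  rcases a with y | ⟨v, n⟩ <;> rcases b with z | ⟨w, k⟩
  · have h0 := hY.2.2.2 y z
    simp only [horoCost, horoHeight, horoProj, ENNReal.toReal_ofReal h0, Real.exp_zero]
    exact ⟨by linarith, by nlinarith⟩
  · simp only [horoCost] at h ⊢
    split_ifs at h ⊢ with h'
    · obtain ⟨rfl, rfl⟩ := h'
      simp only [horoHeight, horoProj, hY.1, Real.exp_zero, ENNReal.toReal_one]
      exact ⟨by norm_num, by linarith⟩
    · exact absurd rfl h
  · simp only [horoCost] at h ⊢
    split_ifs at h ⊢ with h'
    · obtain ⟨rfl, rfl⟩ := h'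
      simp only [horoHeight, horoProj, hY.1, ENNReal.toReal_one]
      exact ⟨by norm_num, by positivity⟩
    · exact absurd rfl h
  · simp only [horoCost] at h ⊢
    split_ifs at h ⊢ with h₁ h₂
    · obtain ⟨rfl, h₁⟩ := h₁
      simp only [horoHeight, horoProj, hY.1, ENNReal.toReal_one]
      refine ⟨?_, by positivity⟩
      rcases h₁ with rfl | rfl <;> push_cast <;> linarith
    · obtain ⟨rfl, -, h₂⟩ := h₂
      simp only [horoHeight, horoProj, ENNReal.toReal_ofReal (Real.exp_nonneg _)]
      refine ⟨by linarith [Real.exp_nonneg (-(n : ℝ))], h₂.trans ?_⟩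
      rw [mul_assoc, ← Real.exp_add]
      have : 1 ≤ Real.exp ((n : ℝ) + 1 + -n) := Real.one_le_exp (by linarith)
      nlinarith
    · exact absurd rfl h

lemma horo_chain_bound (hlam : 1 ≤ lam) (hY : mY.IsPseudo) {b : HoroSpace Y N} :
    ∀ (l : List (HoroSpace Y N)) (a : HoroSpace Y N), l.head? = some a → l.getLast? = some b →
      chainCost (horoCost mY lam N) l ≠ ⊤ →
      horoHeight b ≤ horoHeight a + (chainCost (horoCost mY lam N) l).toReal ∧
        mY.d (horoProj a) (horoProj b) ≤
          20 * lam * Real.exp (horoHeight a + (chainCost (horoCost mY lam N) l).toReal) *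
            (chainCost (horoCost mY lam N) l).toReal
  | [], a, h, _, _ => by simp at h
  | [p], a, h, h', _ => by
      simp only [List.head?_cons, List.getLast?_singleton, Option.some.injEq] at h h'
      subst h h'
      simp [chainCost, hY.1]
  | p :: q :: t, a, h, h', hfin => by
      obtain rfl : p = a := by simpa using h
      simp only [chainCost] at hfin ⊢
      obtain ⟨hc, hl⟩ := ENNReal.add_ne_top.1 hfin
      obtain ⟨ih₁, ih₂⟩ := horo_chain_bound hlam hY (q :: t) q rfl (by simpa using h') hl
      obtain ⟨he₁, he₂⟩ := horo_edge_bound hlam hY p q hc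
      rw [ENNReal.toReal_add hc hl]
      have hcn : 0 ≤ (horoCost mY lam N p q).toReal := ENNReal.toReal_nonneg
      have hln : 0 ≤ (chainCost (horoCost mY lam N) (q :: t)).toReal := ENNReal.toReal_nonneg
      generalize (horoCost mY lam N p q).toReal = C at *
      generalize (chainCost (horoCost mY lam N) (q :: t)).toReal = L at *
      refine ⟨by linarith, (hY.2.2.1 _ (horoProj q) _).trans ?_⟩
      calc mY.d (horoProj p) (horoProj q) + mY.d (horoProj q) (horoProj b)
          ≤ 20 * lam * Real.exp (horoHeight p) * C
              + 20 * lam * Real.exp (horoHeight q + L) * L := add_le_add he₂ ih₂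
        _ ≤ 20 * lam * Real.exp (horoHeight p + (C + L)) * C
              + 20 * lam * Real.exp (horoHeight p + (C + L)) * L := by
            gcongr ?_ * Real.exp ?_ * _ + _ * Real.exp ?_ * _ <;> linarith
        _ = 20 * lam * Real.exp (horoHeight p + (C + L)) * (C + L) := by ring

/-- The height is `1`-Lipschitz on `H(Y)`. -/
lemma horoHeight_sub_le (hlam : 1 ≤ lam) (hY : mY.IsPseudo) (a b : HoroSpace Y N) :
    horoHeight b - horoHeight a ≤ (horoPMet mY lam N).d a b := by
  refine (ENNReal.ofReal_le_iff_le_toReal (horo_pathDist_ne_top hY a b)).1 (le_sInf ?_)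
  rintro _ ⟨l, ⟨hl, hl'⟩, rfl⟩
  by_cases hfin : chainCost (horoCost mY lam N) l = ⊤
  · simp [hfin]
  · rw [ENNReal.ofReal_le_iff_le_toReal hfin]
    linarith [(horo_chain_bound hlam hY l a hl hl' hfin).1]

/-- The inclusion of `Y` in `H(Y)` is at most exponentially distorted. -/
lemma dist_lt_of_horoPMet_lt (hlam : 1 ≤ lam) (hY : mY.IsPseudo) {x y : Y} {M : ℝ}
    (h : (horoPMet mY lam N).d (Sum.inl x) (Sum.inl y) < M) :
    mY.d x y < 20 * lam * Real.exp (2 * M) := by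
  have hlt := (ENNReal.lt_ofReal_iff_toReal_lt
    (horo_pathDist_ne_top hY (Sum.inl x) (Sum.inl y))).2 h
  obtain ⟨_, ⟨l, ⟨hl, hl'⟩, rfl⟩, hlM⟩ := sInf_lt_iff.1 hlt
  have hfin := ne_top_of_lt hlM
  have hb := (horo_chain_bound hlam hY l _ hl hl' hfin).2
  have hM := (ENNReal.lt_ofReal_iff_toReal_lt hfin).1 hlM
  have h0 : 0 ≤ (chainCost (horoCost mY lam N) l).toReal := ENNReal.toReal_nonneg
  generalize (chainCost (horoCost mY lam N) l).toReal = L at *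
  simp only [horoProj, horoHeight, zero_add] at hb
  calc mY.d x y ≤ 20 * lam * Real.exp L * L := hb
    _ ≤ 20 * lam * Real.exp L * Real.exp L := by
        gcongr
        linarith [Real.add_one_le_exp L]
    _ = 20 * lam * Real.exp (2 * L) := by rw [mul_assoc, ← Real.exp_add, two_mul]
    _ < 20 * lam * Real.exp (2 * M) := by gcongr

lemma horo_convInf_vertical (hlam : 1 ≤ lam) (hY : mY.IsPseudo) (v : N) :
    ConvInf (horoPMet mY lam N) (fun n => Sum.inr (v, n)) := by
  intro z r
  obtain ⟨K, hK⟩ := exists_nat_ge (r + horoHeight z)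
  refine ⟨K, fun i hi j hj => ?_⟩
  have hi' : (K : ℝ) ≤ i := by exact_mod_cast hi
  have hj' : (K : ℝ) ≤ j := by exact_mod_cast hj
  have h₁ := horoHeight_sub_le hlam hY z (Sum.inr (v, i))
  have h₂ := horoHeight_sub_le hlam hY z (Sum.inr (v, j))
  have h₃ := horoPMet_vertical_le (lam := lam) hY v i j
  rw [(horoPMet_isPseudo hY).2.1] at h₁ h₂
  have e (n : ℕ) : horoHeight (Sum.inr (v, n) : HoroSpace Y N) = n + 1 := rfl
  rw [e] at h₁ h₂
  simp only [PMet.gp]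
  rcases abs_cases ((i : ℝ) - j) with ⟨h, -⟩ | ⟨h, -⟩ <;> rw [h] at h₃ <;> linarith

end HoroballGeometry

/-- Lemma 5.2. Let `Y` be a `(λ,λ)`-quasi-geodesic space with basepoint
`x₀`, `N` a `10λ`-net in `Y`, and `H(Y)` the combinatorial horoball over the approximation
graph on `N` glued to `Y`, with `ξ` its unique boundary point at infinity. There is an
increasing function `f`, depending only on `λ`, such that for all `x ∈ Y` and `r ≥ 0`, if
`d_Y(x₀, x) ≥ f(r)` then the Gromov product `(x | ξ)_{x₀}` in `H(Y)` is greater than `r`. -/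
theorem horoball_gromov_product_lower_bound (lam : ℝ) (hlam : 1 ≤ lam) :
    ∃ f : ℝ → ℝ, StrictMono f ∧
      ∀ (Y : Type u) (mY : PMet Y), mY.IsPseudo → mY.QuasiGeodesicSpace lam lam →
        ∀ (x0 : Y) (N : Set Y),
          (∀ y : Y, ∃ v ∈ N, mY.d y v ≤ 20 * lam) →
          (∀ v ∈ N, ∀ w ∈ N, v ≠ w → 10 * lam ≤ mY.d v w) →
          ∀ (x : Y) (r : ℝ), 0 ≤ r → f r ≤ mY.d x0 x →
            r < gpBoundaryAll (horoPMet mY lam N) (Sum.inl x0) (Sum.inl x) := by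
  refine ⟨fun r => 20 * lam * Real.exp (2 * (2 * r + 20 * lam + 1)), fun r s hrs => ?_, ?_⟩
  · dsimp only
    gcongr
  intro Y mY hY _ x0 N hnet _ x r _ hx
  have hH := horoPMet_isPseudo (lam := lam) (N := N) hY
  obtain ⟨v, hv, hxv⟩ := hnet x
  have hd : 2 * r + 20 * lam + 1 ≤ (horoPMet mY lam N).d (Sum.inl x0) (Sum.inl x) := by
    by_contra! h
    exact (dist_lt_of_horoPMet_lt hlam hY h).not_ge hx
  refine lt_of_lt_of_le (lt_add_of_pos_right r one_half_pos)
    (hH.le_gpBoundaryAll (horo_convInf_vertical hlam hY ⟨v, hv⟩) fun n => ?_)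
  have h₁ := horoPMet_inl_inr_le (lam := lam) hY x ⟨v, hv⟩ n
  have h₂ := horoHeight_sub_le hlam hY (Sum.inl x0) (Sum.inr (⟨v, hv⟩, n))
  rw [hH.2.1] at hd h₂
  simp only [PMet.gp]
  simp only [horoHeight] at h₁ h₂
  linarith

end HHSPaper
end

section
/- Let X be a quasi-geodesic metric space, G a finitely generated group acting coboundedly by isometries on X, C ≥ 0, and P a G-invariant collection of subsets of X such that: (i) X ⊆ N_C(⋃_{P∈P} P); (ii) whenever P, P' ∈ P both intersect N_{3C}(x) for some x ∈ X, there is a chain P = P_0, P_1, …, P_k = P' in P with N_C(P_i) ∩ N_C(P_{i+1}) of infinite diameter for each i; (iii) the elements of P are uniformly quasiconvex; and (iv) there is a uniform constant such that every infinite-diameter intersection N_C(P) ∩ N_C(P'), for P, P' ∈ P, occurring in condition (ii) is uniformly coarsely connected. If moreover every closed ball of X intersects only finitely many elements of P, then there exists τ ≥ 0 such that whenever P, P' ∈ P both intersect N_{3C}(x), there is a chain P = P_0, P_1, …, P_k = P' in P with k ≤ τ and, for each i, N_C(P_i) ∩ N_C(P_{i+1}) of infinite diameter, τ-coarsely connected,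 and intersecting N_τ(x). -/
/-!
Background definitions for formalizing results of Abbott–Behrstock–Russell,
"Boundaries of relatively hyperbolic hierarchically hyperbolic groups".
-/

namespace HHSPaper

open Set

universe u v

open scoped Classical

namespace PMet

variable {X : Type u} (m : PMet X) (C : ℝ)

/-- `l` is a thick chain in `𝔓` from `P` to `P'`, of length at most `M`, all of whose coarse
intersections come `M`-close to `x`. -/
def IsBoundedThickChain (𝔓 : Set (Set X)) (x : X) (M : ℝ) (P P' : Set X)
    (l : List (Set X)) : Prop :=
  (∀ A ∈ l, A ∈ 𝔓) ∧ l.head? = some P ∧ l.getLast? = some P' ∧ (l.length : ℝ) ≤ M ∧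
    l.IsChain (fun A B => m.Unbounded (m.nbhd A C ∩ m.nbhd B C) ∧
      ∃ z ∈ m.nbhd A C ∩ m.nbhd B C, m.d x z ≤ M)

variable {m C}

lemma CoarselyConnected.mono {c c' : ℝ} (h : c ≤ c') {P : Set X}
    (hP : m.CoarselyConnected c P) : m.CoarselyConnected c' P := by
  intro p hp q hq
  obtain ⟨l, h1, h2, h3, h4⟩ := hP p hp q hq
  refine ⟨l, h1, h2, fun b hb => ?_, h4⟩
  obtain ⟨z, hz, hbz⟩ := h3 b hb
  exact ⟨z, hz, hbz.trans h⟩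

lemma IsBoundedThickChain.mono {𝔓 : Set (Set X)} {x x' : X} {M M' : ℝ} {P P' : Set X}
    {l : List (Set X)} (hl : m.IsBoundedThickChain C 𝔓 x M P P' l) (hM : M ≤ M')
    (hx : ∀ z, m.d x z ≤ M → m.d x' z ≤ M') : m.IsBoundedThickChain C 𝔓 x' M' P P' l := by
  obtain ⟨h1, h2, h3, h4, h5⟩ := hl
  exact ⟨h1, h2, h3, h4.trans hM,
    h5.imp fun A B ⟨hu, z, hz, hd⟩ => ⟨hu, z, hz, hx z hd⟩⟩

/-- A list chained by a relation that holds for some real parameter, monotonically in that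
parameter, is chained for a single parameter. -/
lemma exists_isChain_of_monotone {α : Type*} {R : α → α → Prop} {S : ℝ → α → α → Prop}
    (hS : ∀ r s, r ≤ s → ∀ a b, S r a b → S s a b) (hR : ∀ a b, R a b → ∃ r, S r a b) :
    ∀ l : List α, l.IsChain R → ∃ r, l.IsChain (S r)
  | [], _ => ⟨0, by simp⟩
  | [_], _ => ⟨0, by simp⟩
  | a :: b :: l, h => by
    rw [List.isChain_cons_cons] at h
    obtain ⟨r, hr⟩ := hR a b h.1
    obtain ⟨s, hs⟩ := exists_isChain_of_monotone hS hR (b :: l) h.2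
    exact ⟨max r s, List.isChain_cons_cons.2
      ⟨hS _ _ (le_max_left r s) _ _ hr, hs.imp (hS _ _ (le_max_right r s))⟩⟩

lemma exists_isBoundedThickChain {𝔓 : Set (Set X)} (x : X) {P P' : Set X} {l : List (Set X)}
    (hmem : ∀ A ∈ l, A ∈ 𝔓) (hhead : l.head? = some P) (hlast : l.getLast? = some P')
    (hl : l.IsChain (fun A B => m.Unbounded (m.nbhd A C ∩ m.nbhd B C))) :
    ∃ M, m.IsBoundedThickChain C 𝔓 x M P P' l := by
  obtain ⟨r, hr⟩ := exists_isChain_of_monotone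
    (S := fun r A B => m.Unbounded (m.nbhd A C ∩ m.nbhd B C) ∧
      ∃ z ∈ m.nbhd A C ∩ m.nbhd B C, m.d x z ≤ r)
    (fun r s hrs A B ⟨hu, z, hz, hd⟩ => ⟨hu, z, hz, hd.trans hrs⟩)
    (fun A B hu => by
      obtain ⟨z, hz, -⟩ := hu 0
      exact ⟨m.d x z, hu, z, hz, le_rfl⟩) l hl
  exact ⟨max l.length r, hmem, hhead, hlast, le_max_left _ _,
    hr.imp fun A B ⟨hu, z, hz, hd⟩ => ⟨hu, z, hz, hd.trans (le_max_right _ _)⟩⟩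

lemma map_mem_nbhd {f : X → X} (hf : ∀ x y, m.d (f x) (f y) = m.d x y) {A : Set X} {z : X}
    (hz : z ∈ m.nbhd A C) : f z ∈ m.nbhd (f '' A) C := by
  obtain ⟨p, hp, hd⟩ := hz
  exact ⟨f p, mem_image_of_mem f hp, by rwa [hf]⟩

lemma IsBoundedThickChain.map {𝔓 : Set (Set X)} {f : X → X}
    (hf : ∀ x y, m.d (f x) (f y) = m.d x y) (h𝔓 : ∀ A ∈ 𝔓, f '' A ∈ 𝔓) {x : X} {M : ℝ}
    {P P' : Set X} {l : List (Set X)} (hl : m.IsBoundedThickChain C 𝔓 x M P P' l) :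
    m.IsBoundedThickChain C 𝔓 (f x) M (f '' P) (f '' P') (l.map (f '' ·)) := by
  obtain ⟨h1, h2, h3, h4, h5⟩ := hl
  refine ⟨?_, by simp [h2], by simp [h3], by simpa using h4, ?_⟩
  · intro A hA
    obtain ⟨B, hB, rfl⟩ := List.mem_map.1 hA
    exact h𝔓 B (h1 B hB)
  · rw [List.isChain_map]
    refine h5.imp fun A B ⟨hu, z, hz, hd⟩ => ⟨fun r => ?_, f z,
      ⟨map_mem_nbhd hf hz.1, map_mem_nbhd hf hz.2⟩, by rwa [hf]⟩
    obtain ⟨p, hp, q, hq, hpq⟩ := hu r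
    exact ⟨f p, ⟨map_mem_nbhd hf hp.1, map_mem_nbhd hf hp.2⟩, f q,
      ⟨map_mem_nbhd hf hq.1, map_mem_nbhd hf hq.2⟩, by rwa [hf]⟩

end PMet

/-- Proposition 6.5, case (1). If `X` is thick of order 1 with respect to a
`G`-invariant collection `𝔓` of uniformly quasiconvex subsets with uniformly coarsely
connected coarse intersections, and every closed ball meets only finitely many members of
`𝔓`, then the uniform chain condition of strong thickness of order 1 holds. -/
theorem uniform_thick_chains_of_finite_multiplicity
    {X : Type u} {G : Type v} [Group G] (mX : PMet X)
    (hpseudo : mX.IsPseudo) (lam0 eps0 : ℝ) (hqg : mX.QuasiGeodesicSpace lam0 eps0)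
    (TG : Finset G) (hgen : Subgroup.closure (TG : Set G) = ⊤)
    (a : G → X → X) (ha1 : ∀ x, a 1 x = x) (hamul : ∀ g h x, a (g * h) x = a g (a h x))
    (haiso : ∀ g x y, mX.d (a g x) (a g y) = mX.d x y)
    (hcobdd : ∃ (x0 : X) (C' : ℝ), ∀ x : X, ∃ g : G, mX.d x (a g x0) ≤ C')
    (C : ℝ) (hC : 0 ≤ C) (𝔓 : Set (Set X))
    (hinv : ∀ (g : G), ∀ P ∈ 𝔓, a g '' P ∈ 𝔓)
    (hcover : ∀ x : X, ∃ P ∈ 𝔓, ∃ p ∈ P, mX.d x p ≤ C)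
    (hchains : ∀ P ∈ 𝔓, ∀ P' ∈ 𝔓, ∀ x : X,
      (∃ p ∈ P, mX.d x p ≤ 3 * C) → (∃ p ∈ P', mX.d x p ≤ 3 * C) →
      ∃ l : List (Set X), (∀ A ∈ l, A ∈ 𝔓) ∧ l.head? = some P ∧ l.getLast? = some P' ∧
        l.Chain' (fun A B => mX.Unbounded (mX.nbhd A C ∩ mX.nbhd B C)))
    (hqc : ∃ lam eps : ℝ, 1 ≤ lam ∧ 0 ≤ eps ∧ ∀ P ∈ 𝔓, ∀ p ∈ P, ∀ q ∈ P,
      ∃ γ T, 0 ≤ T ∧ γ 0 = p ∧ γ T = q ∧ mX.IsQuasiGeodesic lam eps γ T ∧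
        ∀ t ∈ Set.Icc 0 T, ∃ z ∈ P, mX.d (γ t) z ≤ eps)
    (hcc : ∃ c : ℝ, ∀ P ∈ 𝔓, ∀ P' ∈ 𝔓,
      mX.Unbounded (mX.nbhd P C ∩ mX.nbhd P' C) →
      mX.CoarselyConnected c (mX.nbhd P C ∩ mX.nbhd P' C))
    (hfin : ∀ (x : X) (r : ℝ), {P | P ∈ 𝔓 ∧ ∃ p ∈ P, mX.d x p ≤ r}.Finite) :
    ∃ τ : ℝ, 0 ≤ τ ∧ ∀ P ∈ 𝔓, ∀ P' ∈ 𝔓, ∀ x : X,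
      (∃ p ∈ P, mX.d x p ≤ 3 * C) → (∃ p ∈ P', mX.d x p ≤ 3 * C) →
      ∃ l : List (Set X), (∀ A ∈ l, A ∈ 𝔓) ∧ l.head? = some P ∧ l.getLast? = some P' ∧
        (l.length : ℝ) ≤ τ + 1 ∧
        l.Chain' (fun A B => mX.Unbounded (mX.nbhd A C ∩ mX.nbhd B C) ∧
          mX.CoarselyConnected τ (mX.nbhd A C ∩ mX.nbhd B C) ∧
          ∃ z ∈ mX.nbhd A C ∩ mX.nbhd B C, mX.d x z ≤ τ) := by
  obtain ⟨-, hsymm, htri, hnn⟩ := hpseudo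
  obtain ⟨x0, C', hx0⟩ := hcobdd
  obtain ⟨c, hc⟩ := hcc
  have hC' : 0 ≤ C' := by
    obtain ⟨g, hg⟩ := hx0 x0
    exact (hnn _ _).trans hg
  -- Near the base point only finitely many pairs occur, so the chains are uniformly bounded.
  have hpair : ∀ q : Set X × Set X, ∃ M : ℝ, ∀ y, q.1 ∈ 𝔓 → q.2 ∈ 𝔓 →
      (∃ p ∈ q.1, mX.d y p ≤ 3 * C) → (∃ p ∈ q.2, mX.d y p ≤ 3 * C) →
      ∃ l, mX.IsBoundedThickChain C 𝔓 x0 M q.1 q.2 l := by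
    intro q
    by_cases h : ∃ y, q.1 ∈ 𝔓 ∧ q.2 ∈ 𝔓 ∧
      (∃ p ∈ q.1, mX.d y p ≤ 3 * C) ∧ (∃ p ∈ q.2, mX.d y p ≤ 3 * C)
    · obtain ⟨y, h1, h2, h3, h4⟩ := h
      obtain ⟨l, hl1, hl2, hl3, hl4⟩ := hchains _ h1 _ h2 y h3 h4
      obtain ⟨M, hM⟩ := PMet.exists_isBoundedThickChain x0 hl1 hl2 hl3 hl4
      exact ⟨M, fun _ _ _ _ _ => ⟨l, hM⟩⟩
    · exact ⟨0, fun y h1 h2 h3 h4 => (h ⟨y, h1, h2, h3, h4⟩).elim⟩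
  choose M hM using hpair
  have hF := hfin x0 (C' + 3 * C)
  obtain ⟨N, hN⟩ := ((hF.prod hF).image M).bddAbove
  refine ⟨max (max 0 c) (N + C'), (le_max_left 0 c).trans (le_max_left _ _), ?_⟩
  intro P hP P' hP' x hPx hPx'
  obtain ⟨g, hg⟩ := hx0 x
  have hinvl : ∀ y, a g⁻¹ (a g y) = y := fun y => by rw [← hamul, inv_mul_cancel, ha1]
  have hinvr : ∀ y, a g (a g⁻¹ y) = y := fun y => by rw [← hamul, mul_inv_cancel, ha1]
  have hdist : mX.d x0 (a g⁻¹ x) ≤ C' := by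
    rw [← haiso g, hinvr, hsymm]
    exact hg
  have hmeet : ∀ Q : Set X, (∃ p ∈ Q, mX.d x p ≤ 3 * C) →
      ∃ p ∈ a g⁻¹ '' Q, mX.d (a g⁻¹ x) p ≤ 3 * C := by
    rintro Q ⟨p, hp, hd⟩
    exact ⟨_, mem_image_of_mem _ hp, by rwa [haiso]⟩
  have hnear : ∀ Q ∈ 𝔓, (∃ p ∈ Q, mX.d x p ≤ 3 * C) →
      a g⁻¹ '' Q ∈ {P | P ∈ 𝔓 ∧ ∃ p ∈ P, mX.d x0 p ≤ C' + 3 * C} := by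
    intro Q hQ hQx
    obtain ⟨p, hp, hd⟩ := hmeet Q hQx
    exact ⟨hinv _ _ hQ, p, hp, (htri _ _ _).trans (add_le_add hdist hd)⟩
  have himage : ∀ Q : Set X, a g '' (a g⁻¹ '' Q) = Q := fun Q => by
    simp only [image_image, hinvr, image_id']
  have hMN : M (a g⁻¹ '' P, a g⁻¹ '' P') ≤ N :=
    hN (mem_image_of_mem M ⟨hnear P hP hPx, hnear P' hP' hPx'⟩)
  obtain ⟨l, hl⟩ := hM (a g⁻¹ '' P, a g⁻¹ '' P') (a g⁻¹ x) (hinv _ _ hP) (hinv _ _ hP')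
    (hmeet P hPx) (hmeet P' hPx')
  have hl' := (hl.map (haiso g) (hinv g)).mono (x' := x) (M' := N + C') (by linarith)
    (fun z hz => by linarith [htri x (a g x0) z])
  rw [himage, himage] at hl'
  obtain ⟨h1, h2, h3, h4, h5⟩ := hl'
  refine ⟨_, h1, h2, h3, ?_, ?_⟩
  · linarith [le_max_right (max 0 c) (N + C')]
  · refine List.isChain_iff_getElem.2 fun i hi => ?_
    obtain ⟨hu, z, hz, hd⟩ := List.isChain_iff_getElem.1 h5 i hi
    exact ⟨hu, (hc _ (h1 _ (List.getElem_mem _)) _ (h1 _ (List.getElem_mem _)) hu).mono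
      ((le_max_right 0 c).trans (le_max_left _ _)), z, hz, hd.trans (le_max_right _ _)⟩

end HHSPaper
end

section
/- Let (G,S) be a G-HHS and let H ≤ G be an infinite hierarchically quasiconvex subgroup with set of eyries {W_1,…,W_n}. Then there exists D ≥ 0, depending on H, such that diam π_V(H) ≤ D for every V ∈ S that is not nested into any W_i. -/
/-!
Background definitions for formalizing results of Abbott–Behrstock–Russell,
"Boundaries of relatively hyperbolic hierarchically hyperbolic groups".
-/

namespace HHSPaper

open Set

universe u v

open scoped Classical

/-- If at most `n` members of a finite family of approximate subgroups of `Γ` can miss any given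
element, and every member misses some element even after being enlarged, then the family has at
most `2 * n` members. -/
lemma card_le_of_approxSubgroups {Γ : Type*} [Group Γ] {ι : Type*} (B : ℕ → ι → Γ → Prop)
    (hmono : ∀ k i h, B k i h → B (k + 1) i h)
    (hmul : ∀ k i h g, B k i h → B k i g → B (k + 1) i (h * g))
    (hinv : ∀ k i h, B k i h → B (k + 1) i h⁻¹) (n : ℕ) :
    ∀ (k : ℕ) (s : Finset ι), (∀ h, (s.filter fun i => ¬ B k i h).card ≤ n) →
      (∀ i ∈ s, ∃ h, ¬ B (k + 4 * n) i h) → s.card ≤ 2 * n := by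
  classical
  have hmono' : ∀ i h k l, k ≤ l → B k i h → B l i h := by
    intro i h k l hkl hB
    induction l, hkl using Nat.le_induction with
    | base => exact hB
    | succ l _ ih => exact hmono l i h ih
  induction n using Nat.strong_induction_on with
  | _ n ih =>
    intro k s hs hprop
    rcases Nat.eq_zero_or_pos n with rfl | hn
    · have : s = ∅ := by
        refine Finset.eq_empty_of_forall_notMem fun i hi => ?_
        obtain ⟨h, hh⟩ := hprop i hi
        have h0 := Finset.card_eq_zero.1 (Nat.le_zero.1 (hs h))
        have : i ∈ s.filter fun i => ¬ B k i h := Finset.mem_filter.2 ⟨hi, by simpa using hh⟩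
        rw [h0] at this
        simp at this
      simp [this]
    by_cases hmax : ∀ h, (s.filter fun i => ¬ B (k + 2) i h).card ≤ n - 1
    · have := ih (n - 1) (by omega) (k + 2) s hmax fun i hi => by
        obtain ⟨h, hh⟩ := hprop i hi
        exact ⟨h, fun hB => hh (hmono' i h _ _ (by omega) hB)⟩
      omega
    push Not at hmax
    obtain ⟨h, hh⟩ := hmax
    set I := s.filter fun i => ¬ B (k + 2) i h with hI
    set J := s.filter fun i => ¬ ¬ B (k + 2) i h with hJ
    have hIJ : I.card + J.card = s.card := Finset.card_filter_add_card_filter_not _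
    have hIle : I.card ≤ n := by
      refine le_trans (Finset.card_le_card ?_) (hs h)
      intro i hi
      rw [hI, Finset.mem_filter] at hi
      exact Finset.mem_filter.2 ⟨hi.1, fun hB => hi.2 (hmono' i h _ _ (by omega) hB)⟩
    have hJle : J.card ≤ 2 * (n / 2) := by
      refine ih (n / 2) (by omega) (k + 4) J (fun g => ?_) fun i hi => ?_
      · set O := J.filter fun i => ¬ B (k + 4) i g with hO
        set A := s.filter fun i => ¬ B k i g with hA
        set C := s.filter fun i => ¬ B k i (h * g) with hC
        have hAn : A.card ≤ n := hs g
        have hCn : C.card ≤ n := hs (h * g)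
        have hsub₁ : I ∪ O ⊆ A ∪ C := by
          intro i hi
          rcases Finset.mem_union.1 hi with hi | hi
          · rw [hI, Finset.mem_filter] at hi
            by_contra hcon
            simp only [Finset.mem_union, hA, hC, Finset.mem_filter, hi.1, true_and, not_or,
              not_not] at hcon
            have := hmul _ i _ _ (hmono _ i _ hcon.2) (hinv _ i _ hcon.1)
            rw [mul_inv_cancel_right] at this
            exact hi.2 this
          · rw [hO, Finset.mem_filter, hJ, Finset.mem_filter] at hi
            exact Finset.mem_union_left _ (Finset.mem_filter.2
              ⟨hi.1.1, fun hB => hi.2 (hmono' i g _ _ (by omega) hB)⟩)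
        have hsub₂ : O ⊆ A ∩ C := by
          intro i hi
          rw [hO, Finset.mem_filter, hJ, Finset.mem_filter, not_not] at hi
          refine Finset.mem_inter.2 ⟨Finset.mem_filter.2
            ⟨hi.1.1, fun hB => hi.2 (hmono' i g _ _ (by omega) hB)⟩, Finset.mem_filter.2
            ⟨hi.1.1, fun hB => hi.2 ?_⟩⟩
          have := hmul _ i _ _ (hinv _ i _ hi.1.2) (hmono' i _ _ (k + 3) (by omega) hB)
          rwa [inv_mul_cancel_left] at this
        have hdisj : Disjoint I O := by
          rw [Finset.disjoint_left]
          intro i hi hi'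
          rw [hI, Finset.mem_filter] at hi
          rw [hO, Finset.mem_filter, hJ, Finset.mem_filter] at hi'
          exact hi'.1.2 hi.2
        have h₁ := Finset.card_le_card hsub₁
        have h₂ := Finset.card_le_card hsub₂
        have h₃ := Finset.card_union_add_card_inter A C
        rw [Finset.card_union_of_disjoint hdisj] at h₁
        omega
      · obtain ⟨h', hh'⟩ := hprop i (Finset.mem_filter.1 hi).1
        exact ⟨h', fun hB => hh' (hmono' i h' _ _ (by omega) hB)⟩
    omega

/-- A set all of whose finite `r`-independent subsets have at most `n` elements is
`r`-dominated by a finite subset. -/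
lemma exists_finset_dominating {α : Type*} (r : α → α → Prop) (A : Set α) (n : ℕ)
    (hrefl : ∀ a, r a a)
    (hn : ∀ s : Finset α, (∀ a ∈ s, a ∈ A) → (∀ a ∈ s, ∀ b ∈ s, r a b ∨ r b a → a = b) →
      s.card ≤ n) :
    ∃ s : Finset α, (∀ a ∈ s, a ∈ A) ∧ ∀ a ∈ A, ∃ b ∈ s, r a b ∨ r b a := by
  classical
  by_contra! hcon
  have key : ∀ m : ℕ, ∃ s : Finset α, (∀ a ∈ s, a ∈ A) ∧
      (∀ a ∈ s, ∀ b ∈ s, r a b ∨ r b a → a = b) ∧ s.card = m := by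
    intro m
    induction m with
    | zero => exact ⟨∅, by simp, by simp, rfl⟩
    | succ m ih =>
      obtain ⟨s, hsA, hs, hcard⟩ := ih
      obtain ⟨a, haA, ha⟩ := hcon s hsA
      have has : a ∉ s := fun h => (ha a h).1 (hrefl a)
      refine ⟨insert a s, ?_, ?_, by rw [Finset.card_insert_of_notMem has, hcard]⟩
      · intro b hb
        rcases Finset.mem_insert.1 hb with rfl | hb
        exacts [haA, hsA b hb]
      · intro b hb c hc hbc
        rcases Finset.mem_insert.1 hb with rfl | hb' <;>
          rcases Finset.mem_insert.1 hc with rfl | hc'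
        · rfl
        · exact absurd hbc (not_or.2 (ha c hc'))
        · exact absurd hbc.symm (not_or.2 (ha b hb'))
        · exact hs b hb' c hc' hbc
  obtain ⟨s, hsA, hs, hcard⟩ := key (n + 1)
  have := hn s hsA hs
  omega

/-- There is a properly nested chain of `n + 1` domains starting at `V`. -/
def HasChainAbove {X : Type u} (P : PreHHS X) (n : ℕ) (V : P.S) : Prop :=
  ∃ l : List P.S, List.IsChain (fun a b => P.ProperNest a b) (V :: l) ∧ l.length = n

lemma hasChainAbove_zero {X : Type u} (P : PreHHS X) (V : P.S) : HasChainAbove P 0 V :=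
  ⟨[], by simp, rfl⟩

lemma HasChainAbove.succ {X : Type u} {P : PreHHS X} {n : ℕ} {V T : P.S}
    (h : HasChainAbove P n T) (hVT : P.ProperNest V T) : HasChainAbove P (n + 1) V := by
  obtain ⟨l, hl, rfl⟩ := h
  exact ⟨T :: l, List.isChain_cons_cons.2 ⟨hVT, hl⟩, rfl⟩

lemma IsHHS.not_hasChainAbove {X : Type u} {mX : PMet X} {E : ℝ} {P : PreHHS X}
    (ax : IsHHS mX E P) {n : ℕ} (hn : ⌈E⌉₊ ≤ n) (V : P.S) : ¬ HasChainAbove P n V := by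
  rintro ⟨l, hl, rfl⟩
  have h₁ := ax.complexity _ hl
  have h₂ : E ≤ l.length := Nat.ceil_le.1 hn
  simp only [List.length_cons, Nat.cast_add, Nat.cast_one] at h₁
  linarith

/-- A form of the passing-up lemma: only boundedly many domains `U` can see a pair of points `x`,
`y` if all domains properly containing such `U` have uniformly bounded distance from `x` to `y`. -/
lemma IsHHS.passing_up {X : Type u} {mX : PMet X} {E : ℝ} {P : PreHHS X}
    (ax : IsHHS mX E P) (K : ℝ) :
    ∃ N : ℕ, ∀ (x y : X) (F : Finset P.S),
      (∀ U ∈ F, E < P.pdist U x y) →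
      (∀ U ∈ F, ∀ T, P.ProperNest U T → P.pdist T x y ≤ K) → F.card ≤ N := by
  classical
  have key : ∀ n : ℕ, ∃ N : ℕ, ∀ (T : P.S) (m : ℕ), ⌈E⌉₊ ≤ m + n → HasChainAbove P m T →
      ∀ (x y : X) (F : Finset P.S), (∀ U ∈ F, P.nest U T) →
      (∀ U ∈ F, E < P.pdist U x y) →
      (∀ U ∈ F, ∀ T, P.ProperNest U T → P.pdist T x y ≤ K) → F.card ≤ N := by
    intro n
    induction n with
    | zero =>
      exact ⟨0, fun T m hm hT => absurd hT (ax.not_hasChainAbove (by simpa using hm) T)⟩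
    | succ n ih =>
      obtain ⟨N, hN⟩ := ih
      refine ⟨1 + ⌊E * K + E⌋₊ * N, fun T m hm hT x y F hFT hF hFK => ?_⟩
      by_cases hall : ∀ U ∈ F, U = T
      · have : F ⊆ {T} := fun U hU => Finset.mem_singleton.2 (hall U hU)
        have := Finset.card_le_card this
        rw [Finset.card_singleton] at this
        omega
      push Not at hall
      obtain ⟨U₀, hU₀, hne⟩ := hall
      have hTK := hFK U₀ hU₀ T ⟨hFT U₀ hU₀, hne⟩
      obtain ⟨l, hl, hlen, hcov⟩ := ax.large_links T x y
      have hlen' : l.length ≤ ⌊E * K + E⌋₊ := by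
        apply Nat.le_floor
        have := mul_le_mul_of_nonneg_left hTK (zero_le_one.trans ax.one_le)
        linarith
      have hsub : F ⊆ {T} ∪ l.toFinset.biUnion fun V => F.filter fun U => P.nest U V := by
        intro U hU
        by_cases hUT : U = T
        · simp [hUT]
        rcases hcov U ⟨hFT U hU, hUT⟩ with ⟨V, hV, hUV⟩ | hle
        · exact Finset.mem_union_right _ (Finset.mem_biUnion.2
            ⟨V, List.mem_toFinset.2 hV, Finset.mem_filter.2 ⟨hU, hUV⟩⟩)
        · exact absurd hle (not_le.2 (hF U hU))
      have hbi : (l.toFinset.biUnion fun V => F.filter fun U => P.nest U V).card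
          ≤ l.toFinset.card * N := by
        refine Finset.card_biUnion_le_card_mul _ _ _ fun V hV => ?_
        refine hN V (m + 1) (by omega) (hT.succ (hl V (List.mem_toFinset.1 hV))) x y _ ?_ ?_ ?_
        · exact fun U hU => (Finset.mem_filter.1 hU).2
        · exact fun U hU => hF U (Finset.mem_filter.1 hU).1
        · exact fun U hU => hFK U (Finset.mem_filter.1 hU).1
      calc F.card ≤ _ := Finset.card_le_card hsub
        _ ≤ _ := Finset.card_union_le _ _
        _ ≤ 1 + ⌊E * K + E⌋₊ * N := by
          rw [Finset.card_singleton]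
          gcongr
          exact hbi.trans (Nat.mul_le_mul_right _ ((List.toFinset_card_le l).trans hlen'))
  obtain ⟨N, hN⟩ := key ⌈E⌉₊
  exact ⟨N, fun x y F hF hFK => hN P.top 0 (by simp) (hasChainAbove_zero P _) x y F
    (fun U _ => ax.nest_top U) hF hFK⟩

section PointDistance

variable {G : Type u} [Group G] {E : ℝ} (𝔊 : GHHS G E)

/-- A chosen point of the projection `π_W(x)`. -/
noncomputable def projPoint (W : 𝔊.pre.S) (x : G) : 𝔊.pre.C W := (𝔊.ax.π_ne W x).choose

lemma projPoint_mem (W : 𝔊.pre.S) (x : G) : projPoint 𝔊 W x ∈ 𝔊.pre.π W x :=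
  (𝔊.ax.π_ne W x).choose_spec

/-- The distance in `C W` between the chosen points of `π_W(x)` and `π_W(y)`. -/
noncomputable def pointDist (W : 𝔊.pre.S) (x y : G) : ℝ :=
  (𝔊.pre.m W).d (projPoint 𝔊 W x) (projPoint 𝔊 W y)

lemma pointDist_comm (W : 𝔊.pre.S) (x y : G) : pointDist 𝔊 W x y = pointDist 𝔊 W y x :=
  (𝔊.ax.space_pseudo W).2.1 _ _

lemma pointDist_triangle (W : 𝔊.pre.S) (x y z : G) :
    pointDist 𝔊 W x z ≤ pointDist 𝔊 W x y + pointDist 𝔊 W y z :=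
  (𝔊.ax.space_pseudo W).2.2.1 _ _ _

lemma pdist_le_pointDist (W : 𝔊.pre.S) (x y : G) : 𝔊.pre.pdist W x y ≤ pointDist 𝔊 W x y := by
  refine csInf_le ⟨0, ?_⟩ (Set.mem_image2_of_mem (projPoint_mem 𝔊 W x) (projPoint_mem 𝔊 W y))
  rintro _ ⟨a, _, b, _, rfl⟩
  exact (𝔊.ax.space_pseudo W).2.2.2 a b

lemma dist_le_pointDist_add (W : 𝔊.pre.S) {x y : G} {a b : 𝔊.pre.C W}
    (ha : a ∈ 𝔊.pre.π W x) (hb : b ∈ 𝔊.pre.π W y) :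
    (𝔊.pre.m W).d a b ≤ pointDist 𝔊 W x y + 2 * E := by
  have h₁ := (𝔊.ax.space_pseudo W).2.2.1 a (projPoint 𝔊 W x) b
  have h₂ := (𝔊.ax.space_pseudo W).2.2.1 (projPoint 𝔊 W x) (projPoint 𝔊 W y) b
  have h₃ := 𝔊.ax.π_bdd W x a ha _ (projPoint_mem 𝔊 W x)
  have h₄ := 𝔊.ax.π_bdd W y _ (projPoint_mem 𝔊 W y) b hb
  unfold pointDist
  linarith

lemma pointDist_le_pdist_add (W : 𝔊.pre.S) (x y : G) :
    pointDist 𝔊 W x y ≤ 𝔊.pre.pdist W x y + 2 * E := by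
  rw [← sub_le_iff_le_add]
  refine le_csInf ((𝔊.ax.π_ne W x).image2 (𝔊.ax.π_ne W y)) ?_
  rintro _ ⟨a, ha, b, hb, rfl⟩
  have h₁ := (𝔊.ax.space_pseudo W).2.2.1 (projPoint 𝔊 W x) a (projPoint 𝔊 W y)
  have h₂ := (𝔊.ax.space_pseudo W).2.2.1 a b (projPoint 𝔊 W y)
  have h₃ := 𝔊.ax.π_bdd W x _ (projPoint_mem 𝔊 W x) a ha
  have h₄ := 𝔊.ax.π_bdd W y b hb _ (projPoint_mem 𝔊 W y)
  unfold pointDist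
  linarith

lemma dist_iso_projPoint_le (g : G) (W : 𝔊.pre.S) (x : G) :
    (𝔊.pre.m (𝔊.act g W)).d (𝔊.iso g W (projPoint 𝔊 W x))
      (projPoint 𝔊 (𝔊.act g W) (g * x)) ≤ 2 * E := by
  obtain ⟨b, hb, hd⟩ := (𝔊.iso_proj g W x).1 _ (Set.mem_image_of_mem _ (projPoint_mem 𝔊 W x))
  have h₁ := (𝔊.ax.space_pseudo (𝔊.act g W)).2.2.1 (𝔊.iso g W (projPoint 𝔊 W x)) b
    (projPoint 𝔊 (𝔊.act g W) (g * x))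
  have h₂ := 𝔊.ax.π_bdd _ _ b hb _ (projPoint_mem 𝔊 (𝔊.act g W) (g * x))
  linarith

lemma pointDist_act_le (g : G) (W : 𝔊.pre.S) (x y : G) :
    pointDist 𝔊 (𝔊.act g W) (g * x) (g * y) ≤ pointDist 𝔊 W x y + 4 * E := by
  obtain ⟨-, hsymm, htri, -⟩ := 𝔊.ax.space_pseudo (𝔊.act g W)
  have hx := dist_iso_projPoint_le 𝔊 g W x
  have hy := dist_iso_projPoint_le 𝔊 g W y
  have h₁ := htri (projPoint 𝔊 (𝔊.act g W) (g * x)) (𝔊.iso g W (projPoint 𝔊 W x))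
    (projPoint 𝔊 (𝔊.act g W) (g * y))
  have h₂ := htri (𝔊.iso g W (projPoint 𝔊 W x)) (𝔊.iso g W (projPoint 𝔊 W y))
    (projPoint 𝔊 (𝔊.act g W) (g * y))
  rw [hsymm] at hx
  rw [𝔊.iso_isometry] at h₂
  unfold pointDist
  linarith

lemma act_inv_act (g : G) (W : 𝔊.pre.S) : 𝔊.act g⁻¹ (𝔊.act g W) = W := by
  rw [← 𝔊.act_mul, inv_mul_cancel, 𝔊.act_one]

lemma act_act_inv (g : G) (W : 𝔊.pre.S) : 𝔊.act g (𝔊.act g⁻¹ W) = W := by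
  rw [← 𝔊.act_mul, mul_inv_cancel, 𝔊.act_one]

lemma pointDist_le_act (g : G) (W : 𝔊.pre.S) (x y : G) :
    pointDist 𝔊 W x y ≤ pointDist 𝔊 (𝔊.act g W) (g * x) (g * y) + 4 * E := by
  have := pointDist_act_le 𝔊 g⁻¹ (𝔊.act g W) (g * x) (g * y)
  rwa [act_inv_act, inv_mul_cancel_left, inv_mul_cancel_left] at this

lemma properNest_act_inv {g : G} {V T : 𝔊.pre.S} (h : 𝔊.pre.ProperNest (𝔊.act g V) T) :
    𝔊.pre.ProperNest V (𝔊.act g⁻¹ T) := by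
  refine ⟨?_, ?_⟩
  · have := 𝔊.act_nest g⁻¹ _ _ h.1
    rwa [act_inv_act] at this
  · rintro rfl
    exact h.2 (act_act_inv 𝔊 g T)

/-- The projection of `H` to `C V` has diameter at most `K`, measured on chosen points. -/
def PointDiamLE (Hsub : Subgroup G) (V : 𝔊.pre.S) (K : ℝ) : Prop :=
  ∀ x ∈ Hsub, ∀ y ∈ Hsub, pointDist 𝔊 V x y ≤ K

variable {𝔊} {Hsub : Subgroup G}

lemma PointDiamLE.mono {V : 𝔊.pre.S} {K L : ℝ} (h : PointDiamLE 𝔊 Hsub V K) (hKL : K ≤ L) :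
    PointDiamLE 𝔊 Hsub V L := fun x hx y hy => (h x hx y hy).trans hKL

lemma PointDiamLE.act {V : 𝔊.pre.S} {K : ℝ} (h : PointDiamLE 𝔊 Hsub V K) {g : G}
    (hg : g ∈ Hsub) : PointDiamLE 𝔊 Hsub (𝔊.act g V) (K + 4 * E) := by
  intro x hx y hy
  have h₁ := h _ (Hsub.mul_mem (Hsub.inv_mem hg) hx) _ (Hsub.mul_mem (Hsub.inv_mem hg) hy)
  have h₂ := pointDist_act_le 𝔊 g V (g⁻¹ * x) (g⁻¹ * y)
  rw [mul_inv_cancel_left, mul_inv_cancel_left] at h₂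
  linarith

/-- If the domains properly containing members of `A` have uniformly bounded projection of `H`,
then for some `θ` the members of `A` on which `H` has projection of diameter more than `θ` lie in
finitely many `H`-orbits. -/
lemma exists_finset_orbit_reps (A : Set 𝔊.pre.S) (K : ℝ)
    (hA : ∀ V ∈ A, ∀ T, 𝔊.pre.ProperNest V T → PointDiamLE 𝔊 Hsub T K) :
    ∃ (θ : ℝ) (s : Finset 𝔊.pre.S), (∀ V ∈ s, V ∈ A) ∧
      ∀ V ∈ A, ¬ PointDiamLE 𝔊 Hsub V θ → ∃ U ∈ s, ∃ g ∈ Hsub, V = 𝔊.act g U := by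
  classical
  obtain ⟨N, hN⟩ := 𝔊.ax.passing_up (K + 4 * E)
  have hE : 1 ≤ E := 𝔊.ax.one_le
  obtain ⟨τ, hτ0, hτs⟩ : ∃ τ : ℕ → ℝ, τ 0 = 3 * E ∧ ∀ k, τ (k + 1) = 2 * τ k + 4 * E :=
    ⟨fun k => Nat.rec (3 * E) (fun _ t => 2 * t + 4 * E) k, rfl, fun _ => rfl⟩
  have hτ : ∀ k, 0 ≤ τ k := by
    intro k
    induction k with
    | zero => rw [hτ0]; linarith
    | succ k ih => rw [hτs]; linarith
  let r : 𝔊.pre.S → 𝔊.pre.S → Prop := fun V U => ∃ g ∈ Hsub, V = 𝔊.act g U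
  have hrsymm : ∀ V U, r V U → r U V := by
    rintro _ U ⟨g, hg, rfl⟩
    exact ⟨g⁻¹, Hsub.inv_mem hg, (act_inv_act 𝔊 g U).symm⟩
  have hrtrans : ∀ U V W, r U V → r V W → r U W := by
    rintro _ _ W ⟨g, hg, rfl⟩ ⟨h, hh, rfl⟩
    exact ⟨g * h, Hsub.mul_mem hg hh, (𝔊.act_mul g h W).symm⟩
  let B : ℕ → 𝔊.pre.S → Hsub → Prop := fun k V h =>
    ∀ g : Hsub, pointDist 𝔊 (𝔊.act g V) 1 h ≤ τ k
  set θ := τ (4 * N) + 4 * E with hθ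
  obtain ⟨s, hsA, hs⟩ := exists_finset_dominating r {V ∈ A | ¬ PointDiamLE 𝔊 Hsub V θ} (2 * N)
    (fun V => ⟨1, Hsub.one_mem, (𝔊.act_one V).symm⟩) (by
      intro s hsA hs
      refine card_le_of_approxSubgroups B ?_ ?_ ?_ N 0 s ?_ ?_
      · intro k V h hB g
        have := hB g
        have := hτ k
        rw [hτs]
        linarith
      · intro k V h g hh hg f
        have h₁ := hh f
        have h₂ := hg (h⁻¹ * f)
        have h₃ := pointDist_triangle 𝔊 (𝔊.act f V) 1 h (h * g : Hsub)
        have h₄ := pointDist_le_act 𝔊 (h : G)⁻¹ (𝔊.act f V) h (h * g : Hsub)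
        rw [← 𝔊.act_mul] at h₄
        simp only [Subgroup.coe_mul, Subgroup.coe_inv, inv_mul_cancel, inv_mul_cancel_left]
          at h₂ h₃ h₄ ⊢
        rw [hτs]
        linarith
      · intro k V h hh f
        have h₁ := hh (h * f)
        have h₂ := pointDist_le_act 𝔊 (h : G) (𝔊.act f V) 1 (h⁻¹ : Hsub)
        rw [← 𝔊.act_mul] at h₂
        simp only [Subgroup.coe_mul, Subgroup.coe_inv, mul_inv_cancel, mul_one] at h₁ h₂ ⊢
        rw [pointDist_comm] at h₁
        have := hτ k
        rw [hτs]
        linarith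
      · intro h
        have hex : ∀ V ∈ s.filter (fun V => ¬ B 0 V h), ∃ g : Hsub,
            τ 0 < pointDist 𝔊 (𝔊.act g V) 1 h := by
          intro V hV
          have := (Finset.mem_filter.1 hV).2
          simpa only [B, not_forall, not_le] using this
        choose! g hg using hex
        have hinj : Set.InjOn (fun V => 𝔊.act (g V) V)
            (s.filter (fun V => ¬ B 0 V h) : Finset 𝔊.pre.S) := by
          intro V hV U hU hVU
          have hV' := (Finset.mem_filter.1 hV).1
          have hU' := (Finset.mem_filter.1 hU).1
          refine hs V hV' U hU' (Or.inl ?_)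
          refine hrtrans V (𝔊.act (g V) V) U (hrsymm _ _ ⟨g V, (g V).2, rfl⟩) ?_
          exact ⟨g U, (g U).2, hVU⟩
        rw [← Finset.card_image_of_injOn hinj]
        refine hN 1 h _ ?_ ?_
        · intro U hU
          obtain ⟨V, hV, rfl⟩ := Finset.mem_image.1 hU
          have h₁ := hg V hV
          have h₂ := pointDist_le_pdist_add 𝔊 (𝔊.act (g V) V) 1 h
          linarith
        · intro U hU T hUT
          obtain ⟨V, hV, rfl⟩ := Finset.mem_image.1 hU
          have h₁ := hA V (hsA V (Finset.mem_filter.1 hV).1).1 _ (properNest_act_inv 𝔊 hUT)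
          have h₂ := h₁.act (g V).2 1 Hsub.one_mem h h.2
          rw [act_act_inv] at h₂
          exact (pdist_le_pointDist 𝔊 T 1 h).trans h₂
      · intro V hV
        have hV' := (hsA V hV).2
        simp only [PointDiamLE, not_forall, not_le] at hV'
        obtain ⟨x, hx, y, hy, hxy⟩ := hV'
        refine ⟨⟨x⁻¹ * y, Hsub.mul_mem (Hsub.inv_mem hx) hy⟩, fun hB => ?_⟩
        have h₁ := hB ⟨x⁻¹, Hsub.inv_mem hx⟩
        have h₂ := pointDist_le_act 𝔊 x⁻¹ V x y
        rw [inv_mul_cancel] at h₂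
        rw [zero_add] at h₁
        dsimp only at h₁
        linarith)
  refine ⟨θ, s, fun V hV => (hsA V hV).1, fun V hV hVθ => ?_⟩
  obtain ⟨U, hU, h | h⟩ := hs V ⟨hV, hVθ⟩
  exacts [⟨U, hU, h⟩, ⟨U, hU, hrsymm _ _ h⟩]

/-- If `H` has bounded projection to every domain in a set closed under passing to larger domains,
then these projections are uniformly bounded. -/
lemma exists_uniform_pointDiamLE (A : Set 𝔊.pre.S)
    (hup : ∀ V ∈ A, ∀ T, 𝔊.pre.nest V T → T ∈ A)
    (hbdd : ∀ V ∈ A, ∃ K, PointDiamLE 𝔊 Hsub V K) :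
    ∃ K, ∀ V ∈ A, PointDiamLE 𝔊 Hsub V K := by
  have key : ∀ n : ℕ, ∃ K, ∀ V ∈ A, ¬ HasChainAbove 𝔊.pre n V → PointDiamLE 𝔊 Hsub V K := by
    intro n
    induction n with
    | zero => exact ⟨0, fun V _ hV => absurd (hasChainAbove_zero _ V) hV⟩
    | succ n ih =>
      obtain ⟨K, hK⟩ := ih
      obtain ⟨θ, s, hsA, hs⟩ := exists_finset_orbit_reps (Hsub := Hsub)
        {V ∈ A | ¬ HasChainAbove 𝔊.pre (n + 1) V} K
        fun V hV T hVT => hK T (hup V hV.1 T hVT.1) fun hT => hV.2 (hT.succ hVT)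
      choose! L hL using hbdd
      obtain ⟨M, hM⟩ := (s.image L).bddAbove
      refine ⟨max θ (M + 4 * E), fun V hVA hV => ?_⟩
      by_cases hθ : PointDiamLE 𝔊 Hsub V θ
      · exact hθ.mono (le_max_left _ _)
      obtain ⟨U, hU, g, hg, rfl⟩ := hs V ⟨hVA, hV⟩ hθ
      have hUM : L U ≤ M := hM (Finset.mem_image_of_mem L hU)
      exact (((hL U (hsA U hU).1).mono hUM).act hg).mono (le_max_right _ _)
  obtain ⟨K, hK⟩ := key ⌈E⌉₊
  exact ⟨K, fun V hV => hK V hV (𝔊.ax.not_hasChainAbove le_rfl V)⟩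

end PointDistance

/-- Lemma 6.10. Let `H` be an infinite hierarchically quasiconvex subgroup
of a `G`-HHS with set of eyries `Ws`. Then there is `D ≥ 0` such that `diam π_V(H) ≤ D` for
every domain `V` not nested into any eyrie. -/
theorem bounded_projections_outside_eyries
    {G : Type u} [Group G] {E : ℝ} (𝔊 : GHHS G E) (Hsub : Subgroup G)
    (hinf : (Hsub : Set G).Infinite) (k : ℝ → ℝ)
    (hqc : HQC 𝔊.mG 𝔊.pre k (Hsub : Set G))
    (Ws : Finset 𝔊.pre.S) (hey : IsEyrieSet 𝔊 Hsub Ws) :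
    ∃ D : ℝ, 0 ≤ D ∧ ∀ V : 𝔊.pre.S, (¬ ∃ W ∈ Ws, 𝔊.pre.nest V W) →
      (𝔊.pre.m V).diamLE (𝔊.pre.projSet V (Hsub : Set G)) D := by
  obtain ⟨-, -, -, hmax⟩ := hey
  obtain ⟨K, hK⟩ := exists_uniform_pointDiamLE (𝔊 := 𝔊) (Hsub := Hsub)
    {V | ¬ ∃ W ∈ Ws, 𝔊.pre.nest V W}
    (fun V hV T hVT ⟨W, hW, hTW⟩ => hV ⟨W, hW, 𝔊.ax.nest_trans V T W hVT hTW⟩)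
    (fun V hV => by
      have hV' : ¬ (𝔊.pre.m V).Unbounded (𝔊.pre.projSet V (Hsub : Set G)) :=
        fun h => hV (hmax V h)
      simp only [PMet.Unbounded, not_forall, not_exists, not_and, not_lt] at hV'
      obtain ⟨r, hr⟩ := hV'
      exact ⟨r, fun x hx y hy => hr _ (Set.mem_biUnion hx (projPoint_mem 𝔊 V x)) _
        (Set.mem_biUnion hy (projPoint_mem 𝔊 V y))⟩)
  refine ⟨max 0 (K + 2 * E), le_max_left _ _, fun V hV a ha b hb => ?_⟩
  obtain ⟨x, hx, hax⟩ := Set.mem_iUnion₂.1 ha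
  obtain ⟨y, hy, hby⟩ := Set.mem_iUnion₂.1 hb
  have h₁ := dist_le_pointDist_add 𝔊 V hax hby
  have h₂ := hK V hV x hx y hy
  exact le_max_of_le_right (by linarith)

end HHSPaper
end
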